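/- arXiv:0909.5674 — 2 statements merged into one kernel-verified Lean document; each statement's English description precedes it below -/
import Mathlib

section
/- Existence for a weakened coupling constant (Section 3.4, first Proposition): Fix ε with −1 < ε < 0 and suppose |t| ≠ 1 and that η ≠ 0 or μ ≠ 0. Then there exist d > 0 and a solution ψ of the perturbed model Lichnerowicz equation L_d^ε satisfying ψ(0) = 1. -/
open Real Filter

/-- The 2π-periodic function equal to −1 on (−π,0) and 1 on (0,π). -/
noncomputable def lam (x : ℝ) : ℝ := if 0 < Real.sin x then 1 else -1

/-- The critical exponent q = 2n/(n−2). -/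
noncomputable def qex (n : ℕ) : ℝ := 2 * n / ((n : ℝ) - 2)

/-- The coupling constant κ = (n−1)/n. -/
noncomputable def kap (n : ℕ) : ℝ := ((n : ℝ) - 1) / n

/-- A solution of the perturbed model Lichnerowicz equation `L_d^ε`, arising from the
constraint equations with momentum constraint div K − (1+ε) d(tr K) = 0. -/
def IsPertModelSolution (n : ℕ) (t γ η μ ε d : ℝ) (ψ : ℝ → ℝ) : Prop :=
  (∀ x, ψ (x + 2 * Real.pi) = ψ x) ∧
  (∀ x, 0 < ψ x) ∧
  ContDiff ℝ 1 ψ ∧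
  ∀ x : ℝ, (∀ k : ℤ, x ≠ (k : ℝ) * Real.pi) →
    DifferentiableAt ℝ (deriv ψ) x ∧
    -2 * kap n * qex n * d ^ (-(qex n - 2)) * deriv (deriv ψ) x
      - 2 * η ^ 2 * d ^ (-(2 * qex n)) * ψ x ^ (-qex n - 1)
      - kap n * ((1 + ε) * (γ + lam x) + μ * d ^ (-qex n)) ^ 2 * ψ x ^ (-qex n - 1)
      + kap n * (t + lam x) ^ 2 * ψ x ^ (qex n - 1) = 0

namespace LichnerowiczModel

open Set MeasureTheory Topology

/-- The resolvent `(-∂² + k²)⁻¹` on the real line, as convolution with its Green function. -/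
noncomputable def greenOp (k : ℝ) (f : ℝ → ℝ) (x : ℝ) : ℝ :=
  ∫ y, exp (-(k * |x - y|)) / (2 * k) * f y

theorem integral_exp_neg_mul_abs {k : ℝ} (hk : 0 < k) :
    ∫ y : ℝ, exp (-(k * |y|)) = 2 / k := by
  rw [integral_comp_abs (f := fun y => exp (-(k * y)))]
  have := integral_exp_mul_Ioi (neg_lt_zero.2 hk) 0
  simp only [neg_mul] at this
  rw [this]
  simp
  ring

theorem integrable_exp_neg_mul_abs {k : ℝ} (hk : 0 < k) :
    Integrable fun y : ℝ => exp (-(k * |y|)) :=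
  Integrable.of_integral_ne_zero (by rw [integral_exp_neg_mul_abs hk]; positivity)

theorem integrable_green {k : ℝ} (hk : 0 < k) (x : ℝ) :
    Integrable fun y : ℝ => exp (-(k * |x - y|)) / (2 * k) :=
  ((integrable_exp_neg_mul_abs hk).comp_sub_left x).div_const _

theorem integrable_green_mul {k : ℝ} (hk : 0 < k) (x : ℝ) {f : ℝ → ℝ} (hf : Measurable f) {C : ℝ}
    (hC : ∀ y, |f y| ≤ C) :
    Integrable fun y : ℝ => exp (-(k * |x - y|)) / (2 * k) * f y :=
  (integrable_green hk x).mul_bdd (c := C) hf.aestronglyMeasurable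
    (Eventually.of_forall fun y => by simpa using hC y)

theorem greenOp_const {k : ℝ} (hk : 0 < k) (c x : ℝ) : greenOp k (fun _ => c) x = c / k ^ 2 := by
  unfold greenOp
  rw [integral_mul_const, integral_div,
    integral_sub_left_eq_self (fun y => exp (-(k * |y|))) volume x, integral_exp_neg_mul_abs hk]
  field_simp

theorem greenOp_sub {k : ℝ} (hk : 0 < k) {f g : ℝ → ℝ} (hf : Measurable f) (hg : Measurable g)
    {C : ℝ} (hfC : ∀ y, |f y| ≤ C) (hgC : ∀ y, |g y| ≤ C) (x : ℝ) :
    greenOp k f x - greenOp k g x = greenOp k (fun y => f y - g y) x := by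
  unfold greenOp
  rw [← integral_sub (integrable_green_mul hk x hf hfC) (integrable_green_mul hk x hg hgC)]
  simp only [mul_sub]

theorem greenOp_le {k : ℝ} (hk : 0 < k) {f : ℝ → ℝ} (hf : Measurable f)
    {C : ℝ} (hfC : ∀ y, |f y| ≤ C) {c : ℝ} (hc : ∀ y, f y ≤ c) (x : ℝ) :
    greenOp k f x ≤ c / k ^ 2 := by
  rw [← greenOp_const hk c x]
  exact integral_mono (integrable_green_mul hk x hf hfC) ((integrable_green hk x).mul_const c)
    fun y => mul_le_mul_of_nonneg_left (hc y) (by positivity)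

theorem abs_greenOp_le {k : ℝ} (hk : 0 < k) {f : ℝ → ℝ} (hf : Measurable f)
    {C : ℝ} (hfC : ∀ y, |f y| ≤ C) (x : ℝ) :
    |greenOp k f x| ≤ C / k ^ 2 := by
  refine abs_le.2 ⟨?_, greenOp_le hk hf hfC (fun y => (le_abs_self _).trans (hfC y)) x⟩
  have := greenOp_le hk hf.neg (C := C) (by simpa using hfC) (c := C)
    (fun y => (neg_le_abs _).trans (hfC y)) x
  have h2 : greenOp k (-f) x = - greenOp k f x := by
    simp [greenOp, integral_neg]
  linarith

theorem greenOp_add_right (k : ℝ) (f : ℝ → ℝ) (c x : ℝ) :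
    greenOp k f (x + c) = greenOp k (fun y => f (y + c)) x := by
  unfold greenOp
  rw [← integral_add_right_eq_self (fun y => exp (-(k * |x + c - y|)) / (2 * k) * f y) c]
  simp

/-- Comparison principle for `u = (-∂² + k²)⁻¹ f`. -/
theorem greenOp_comparison {k : ℝ} (hk : 0 < k) {f g : ℝ → ℝ} (hf : Measurable f)
    (hg : Measurable g) {C : ℝ} (hfC : ∀ y, |f y| ≤ C) (hgC : ∀ y, |g y| ≤ C) {L : ℝ}
    (hL : 0 ≤ L) (hLk : L < k ^ 2)
    (hfg : ∀ y, f y - g y ≤ L * max 0 (greenOp k f y - greenOp k g y)) (x : ℝ) :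
    greenOp k f x ≤ greenOp k g x := by
  have hk2 : 0 < k ^ 2 := by positivity
  set φ : ℝ → ℝ := fun y => max 0 (greenOp k f y - greenOp k g y) with hφ
  have hbdd : BddAbove (range φ) := by
    refine ⟨C / k ^ 2 + C / k ^ 2, ?_⟩
    rintro _ ⟨y, rfl⟩
    have h1 := abs_le.1 (abs_greenOp_le hk hf hfC y)
    have h2 := abs_le.1 (abs_greenOp_le hk hg hgC y)
    have hC0 : 0 ≤ C := (abs_nonneg _).trans (hfC 0)
    refine max_le (by positivity) (by linarith)
  set S := ⨆ y, φ y with hS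
  have hle : ∀ y, φ y ≤ S := fun y => le_ciSup hbdd y
  have hS0 : 0 ≤ S := (le_max_left _ _).trans (hle 0)
  have hstep : ∀ y, φ y ≤ L * S / k ^ 2 := by
    intro y
    refine max_le (by positivity) ?_
    rw [greenOp_sub hk hf hg hfC hgC]
    refine greenOp_le hk (hf.sub hg) (C := C + C) (fun z => ?_) (fun z => ?_) y
    · exact (abs_sub _ _).trans (add_le_add (hfC z) (hgC z))
    · exact (hfg z).trans (mul_le_mul_of_nonneg_left (hle z) hL)
  have h1 : S ≤ L * S / k ^ 2 := ciSup_le hstep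
  rw [le_div_iff₀ hk2] at h1
  have h3 : S ≤ 0 := by nlinarith
  have := (le_max_right 0 _).trans ((hle x).trans h3)
  linarith

theorem continuous_greenOp {P : Type*} [TopologicalSpace P] [FirstCountableTopology P] {k : ℝ}
    (hk : 0 < k) {f : P → ℝ → ℝ} (hf : ∀ p, Measurable (f p)) {C : ℝ} (hfC : ∀ p y, |f p y| ≤ C)
    (hcont : ∀ y, Continuous fun p => f p y) :
    Continuous fun z : P × ℝ => greenOp k (f z.1) z.2 := by
  refine continuous_iff_continuousAt.2 fun z₀ => ?_
  have hC0 : 0 ≤ C := (abs_nonneg _).trans (hfC z₀.1 0)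
  refine continuousAt_of_dominated
    (bound := fun y => exp k * (exp (-(k * |z₀.2 - y|)) / (2 * k) * C)) ?_ ?_ ?_ ?_
  · exact Eventually.of_forall fun z => (integrable_green_mul hk z.2 (hf z.1) (hfC z.1)).1
  · have : ∀ᶠ z : P × ℝ in 𝓝 z₀, |z.2 - z₀.2| < 1 := by
      have : Continuous fun z : P × ℝ => |z.2 - z₀.2| := by fun_prop
      exact this.continuousAt.eventually_lt continuousAt_const (by simp)
    filter_upwards [this] with z hz
    refine Eventually.of_forall fun y => ?_
    rw [norm_mul, Real.norm_eq_abs, Real.norm_eq_abs, abs_of_pos (by positivity)]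
    have h1 : exp (-(k * |z.2 - y|)) ≤ exp k * exp (-(k * |z₀.2 - y|)) := by
      rw [← Real.exp_add]
      refine Real.exp_le_exp.2 ?_
      have := abs_sub_le z₀.2 z.2 y
      rw [abs_sub_comm z₀.2 z.2] at this
      nlinarith
    calc exp (-(k * |z.2 - y|)) / (2 * k) * |f z.1 y|
        ≤ exp k * exp (-(k * |z₀.2 - y|)) / (2 * k) * C := by
          gcongr
          exact hfC _ _
      _ = _ := by ring
  · exact ((integrable_green hk _).mul_const C).const_mul _
  · refine Eventually.of_forall fun y => Continuous.continuousAt ?_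
    have := (hcont y).comp (continuous_fst (X := P) (Y := ℝ))
    exact Continuous.mul (by fun_prop) this

theorem integral_Iic_eq_add_interval {g : ℝ → ℝ} (hg : ∀ x, IntegrableOn g (Iic x)) (x : ℝ) :
    ∫ y in Iic x, g y = (∫ y in Iic 0, g y) + ∫ y in (0 : ℝ)..x, g y := by
  have := intervalIntegral.integral_Iic_sub_Iic (hg 0) (hg x)
  linarith

theorem integral_Ioi_eq_sub_interval {g : ℝ → ℝ} (hg : ∀ x, IntegrableOn g (Ioi x)) (x : ℝ) :
    ∫ y in Ioi x, g y = (∫ y in Ioi 0, g y) - ∫ y in (0 : ℝ)..x, g y := by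
  rcases le_total 0 x with h | h
  · have := intervalIntegral.integral_Ioi_sub_Ioi (hg 0) h
    linarith
  · have := intervalIntegral.integral_Ioi_sub_Ioi (hg x) h
    rw [intervalIntegral.integral_symm]
    linarith

theorem greenOp_eq {k : ℝ} (hk : 0 < k) {f : ℝ → ℝ} (hf : Measurable f) {C : ℝ}
    (hfC : ∀ y, |f y| ≤ C) (x : ℝ) :
    greenOp k f x =
      (exp (-(k * x)) * ((∫ y in Iic 0, exp (k * y) * f y) + ∫ y in (0 : ℝ)..x, exp (k * y) * f y) +
      exp (k * x) * ((∫ y in Ioi 0, exp (-k * y) * f y) - ∫ y in (0 : ℝ)..x, exp (-k * y) * f y))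
        / (2 * k) := by
  have h1 : ∀ x, IntegrableOn (fun y => exp (k * y) * f y) (Iic x) := fun x =>
    (integrableOn_exp_mul_Iic hk x).mul_bdd (c := C) hf.aestronglyMeasurable
      (Eventually.of_forall fun y => by simpa using hfC y)
  have h2 : ∀ x, IntegrableOn (fun y => exp (-k * y) * f y) (Ioi x) := fun x =>
    (integrableOn_exp_mul_Ioi (neg_lt_zero.2 hk) x).mul_bdd (c := C) hf.aestronglyMeasurable
      (Eventually.of_forall fun y => by simpa using hfC y)
  rw [← integral_Iic_eq_add_interval h1, ← integral_Ioi_eq_sub_interval h2, add_div]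
  have hint := integrable_green_mul hk x hf hfC
  unfold greenOp
  rw [← intervalIntegral.integral_Iic_add_Ioi hint.integrableOn hint.integrableOn (b := x)]
  congr 1
  · rw [← integral_const_mul, ← integral_div]
    refine setIntegral_congr_fun measurableSet_Iic fun y hy => ?_
    have hy : y ≤ x := hy
    simp only [abs_of_nonneg (sub_nonneg.2 hy)]
    rw [show -(k * (x - y)) = -(k * x) + k * y by ring, Real.exp_add]
    ring
  · rw [← integral_const_mul, ← integral_div]
    refine setIntegral_congr_fun measurableSet_Ioi fun y hy => ?_
    have hy : x < y := hy
    simp only [abs_of_neg (sub_neg.2 hy)]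
    rw [show -(k * -(x - y)) = k * x + -k * y by ring, Real.exp_add]
    ring

/-- If `f` is bounded and continuous off a countable set, then `u = (-∂² + k²)⁻¹ f` is `C¹` and
solves `u'' = k² u - f` off that set. -/
theorem exists_deriv_greenOp {k : ℝ} (hk : 0 < k) {f : ℝ → ℝ} (hf : Measurable f) {C : ℝ}
    (hfC : ∀ y, |f y| ≤ C) {s : Set ℝ} (hs : s.Countable) (hfs : ∀ x ∉ s, ContinuousAt f x) :
    ∃ w : ℝ → ℝ, Continuous w ∧ (∀ x, HasDerivAt (greenOp k f) (w x) x) ∧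
      ∀ x ∉ s, HasDerivAt w (k ^ 2 * greenOp k f x - f x) x := by
  set c₁ := ∫ y in Iic 0, exp (k * y) * f y
  set c₂ := ∫ y in Ioi 0, exp (-k * y) * f y
  set F₁ : ℝ → ℝ := fun x => ∫ y in (0 : ℝ)..x, exp (k * y) * f y with hF₁
  set F₂ : ℝ → ℝ := fun x => ∫ y in (0 : ℝ)..x, exp (-k * y) * f y with hF₂
  have hii : ∀ (c a b : ℝ), IntervalIntegrable (fun y => exp (c * y) * f y) volume a b := by
    intro c a b
    refine IntervalIntegrable.continuousOn_mul ?_ (by fun_prop)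
    rw [intervalIntegrable_iff]
    exact Measure.integrableOn_of_bounded (M := C) (by simp) hf.aestronglyMeasurable
      (Eventually.of_forall fun y => by simpa using hfC y)
  have hmeas : ∀ (c : ℝ) x, StronglyMeasurableAtFilter (fun y => exp (c * y) * f y) (𝓝 x) volume :=
    fun c x => (Measurable.stronglyMeasurable (by fun_prop)).stronglyMeasurableAtFilter
  have hcF₁ : Continuous F₁ := intervalIntegral.continuous_primitive (hii k) 0
  have hcF₂ : Continuous F₂ := intervalIntegral.continuous_primitive (hii (-k)) 0
  have hdF₁ : ∀ x ∉ s, HasDerivAt F₁ (exp (k * x) * f x) x := fun x hx =>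
    intervalIntegral.integral_hasDerivAt_right (hii k 0 x) (hmeas k x)
      (ContinuousAt.mul (by fun_prop) (hfs x hx))
  have hdF₂ : ∀ x ∉ s, HasDerivAt F₂ (exp (-k * x) * f x) x := fun x hx =>
    intervalIntegral.integral_hasDerivAt_right (hii (-k) 0 x) (hmeas (-k) x)
      (ContinuousAt.mul (by fun_prop) (hfs x hx))
  have hu : greenOp k f = fun x =>
      (exp (-(k * x)) * (c₁ + F₁ x) + exp (k * x) * (c₂ - F₂ x)) / (2 * k) :=
    funext fun x => greenOp_eq hk hf hfC x
  set w : ℝ → ℝ := fun x =>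
      (-exp (-(k * x)) * (c₁ + F₁ x) + exp (k * x) * (c₂ - F₂ x)) / 2 with hw
  have hcw : Continuous w := by fun_prop
  have hcu : Continuous (greenOp k f) := by rw [hu]; fun_prop
  have hexp : ∀ c x : ℝ, HasDerivAt (fun x => exp (c * x)) (exp (c * x) * c) x := fun c x => by
    simpa using ((hasDerivAt_id x).const_mul c).exp
  have hexp' : ∀ x : ℝ, HasDerivAt (fun x => exp (-(k * x))) (-(exp (-(k * x)) * k)) x := fun x => by
    simpa using hexp (-k) x
  have hprod : ∀ x : ℝ, exp (-(k * x)) * exp (k * x) = 1 := fun x => by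
    rw [← Real.exp_add]; simp
  have hdu : ∀ x ∉ s, HasDerivAt (greenOp k f) (w x) x := by
    intro x hx
    rw [hu]
    have := ((((hexp' x).mul ((hdF₁ x hx).const_add c₁))).add
      ((hexp k x).mul ((hdF₂ x hx).const_sub c₂))).div_const (2 * k)
    refine this.congr_deriv ?_
    simp only [hw, neg_mul, Real.exp_neg]
    field_simp
    ring
  refine ⟨w, hcw, fun x => ?_, fun x hx => ?_⟩
  · have hint : ∀ x, greenOp k f x = greenOp k f 0 + ∫ y in (0 : ℝ)..x, w y := by
      intro x
      rw [integral_eq_of_hasDerivAt_off_countable (greenOp k f) w hs hcu.continuousOn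
        (fun y hy => hdu y hy.2) (hcw.intervalIntegrable _ _)]
      ring
    rw [show greenOp k f = fun x => greenOp k f 0 + ∫ y in (0 : ℝ)..x, w y from funext hint]
    exact ((hcw.integral_hasStrictDerivAt 0 x).hasDerivAt).const_add _
  · have := ((((hexp' x).neg.mul ((hdF₁ x hx).const_add c₁))).add
      ((hexp k x).mul ((hdF₂ x hx).const_sub c₂))).div_const 2
    refine this.congr_deriv ?_
    rw [hu]
    have := hprod x
    simp only [neg_mul, Pi.neg_apply]
    field_simp
    linear_combination (-(2 * f x)) * this

/-- Every `C²` function of period `T > 0` is recovered from `k² w - w''`. -/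
theorem greenOp_of_periodic {k : ℝ} (hk : 0 < k) {w w' w'' : ℝ → ℝ}
    (hw : ∀ x, HasDerivAt w (w' x) x) (hw' : ∀ x, HasDerivAt w' (w'' x) x) (hc : Continuous w'')
    {T : ℝ} (hT : 0 < T) (hper : Function.Periodic w T) {C : ℝ}
    (hC : ∀ x, |k ^ 2 * w x - w'' x| ≤ C) (x : ℝ) :
    greenOp k (fun y => k ^ 2 * w y - w'' y) x = w x := by
  have hcw : Continuous w := continuous_iff_continuousAt.2 fun x => (hw x).continuousAt
  have hcf : Continuous fun y => k ^ 2 * w y - w'' y := by fun_prop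
  obtain ⟨v, -, hv, hv'⟩ := exists_deriv_greenOp hk hcf.measurable hC countable_empty
    (fun x _ => hcf.continuousAt)
  set u := greenOp k (fun y => k ^ 2 * w y - w'' y) with hu
  have hperd : ∀ {g g' : ℝ → ℝ}, (∀ x, HasDerivAt g (g' x) x) → Function.Periodic g T →
      Function.Periodic g' T := by
    intro g g' hg hp x
    have h1 : HasDerivAt (fun y => g (y + T)) (g' (x + T)) x := (hg (x + T)).comp_add_const x T
    rw [show (fun y => g (y + T)) = g from funext hp] at h1
    exact h1.unique (hg x)
  have hw'p := hperd hw hper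
  have hw''p := hperd hw' hw'p
  have hup : Function.Periodic u T := fun x => by
    rw [hu, greenOp_add_right]
    congr 1
    funext y
    rw [hper y, hw''p y]
  have hvp := hperd hv hup
  have key : ∀ c : ℝ, c ≠ 0 → c ^ 2 = k ^ 2 → v x - w' x = c * (u x - w x) := by
    intro c hc0 hck
    have hd : ∀ x, HasDerivAt (fun x => ((v x - w' x) - c * (u x - w x)) * exp (c * x)) 0 x := by
      intro x
      have he : HasDerivAt (fun x => exp (c * x)) (exp (c * x) * c) x := by
        simpa using ((hasDerivAt_id x).const_mul c).exp
      have := (((hv' x (by simp)).sub (hw' x)).sub (((hv x).sub (hw x)).const_mul c)).mul he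
      refine this.congr_deriv ?_
      simp only [Pi.sub_apply]
      linear_combination (-exp (c * x) * (u x - w x)) * hck
    have hconst := is_const_of_deriv_eq_zero (fun x => (hd x).differentiableAt)
      (fun x => (hd x).deriv) x (x + T)
    simp only [hvp x, hw'p x, hup x, hper x, mul_add, Real.exp_add] at hconst
    have hne : exp (c * T) ≠ 1 := by
      rw [Ne, Real.exp_eq_one_iff]
      exact mul_ne_zero hc0 hT.ne'
    have : ((v x - w' x) - c * (u x - w x)) * (exp (c * x) * (exp (c * T) - 1)) = 0 := by
      linarith
    have h3 := (mul_eq_zero.1 this).resolve_right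
      (mul_ne_zero (Real.exp_pos _).ne' (sub_ne_zero.2 hne))
    linarith
  have h1 := key k hk.ne' rfl
  have h2 := key (-k) (neg_ne_zero.2 hk.ne') (by ring)
  have : 2 * k * (u x - w x) = 0 := by linarith
  have := (mul_eq_zero.1 this).resolve_left (by positivity)
  linarith

/-- A family of semilinear problems `u = (-∂² + k²)⁻¹ h(p, ·, u)`, with `h` monotone and
`L`-Lipschitz in `u` for some `L < k²`, has a solution depending continuously on the parameter. -/
theorem exists_greenOp_fixed_family {P : Type*} [TopologicalSpace P] [FirstCountableTopology P]
    {k : ℝ} (hk : 0 < k) {L : ℝ} (hL : 0 ≤ L) (hLk : L < k ^ 2) {h : P → ℝ → ℝ → ℝ} {C : ℝ}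
    (hlip : ∀ p x u v, h p x u - h p x v ≤ L * max 0 (u - v))
    (hC : ∀ p x u, |h p x u| ≤ C)
    (hmeas : ∀ p (φ : ℝ → ℝ), Continuous φ → Measurable fun x => h p x (φ x))
    (hcont : ∀ x, Continuous fun z : P × ℝ => h z.1 x z.2) :
    ∃ Ψ : P → ℝ → ℝ, (Continuous fun z : P × ℝ => Ψ z.1 z.2) ∧
      ∀ p, Ψ p = greenOp k (fun y => h p y (Ψ p y)) := by
  have hk2 : 0 < k ^ 2 := by positivity
  have hlip' : ∀ p x u v, |h p x u - h p x v| ≤ L * |u - v| := by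
    intro p x u v
    have h1 := hlip p x u v
    have h2 := hlip p x v u
    have h3 : max 0 (u - v) ≤ |u - v| := max_le (abs_nonneg _) (le_abs_self _)
    have h4 : max 0 (v - u) ≤ |u - v| :=
      max_le (abs_nonneg _) (by rw [abs_sub_comm]; exact le_abs_self _)
    exact abs_le.2 ⟨by nlinarith, by nlinarith⟩
  have hslice : ∀ (u : BoundedContinuousFunction (P × ℝ) ℝ) p, Continuous fun x => u (p, x) :=
    fun u p => by fun_prop
  have hm : ∀ (u : BoundedContinuousFunction (P × ℝ) ℝ) p,
      Measurable fun y => h p y (u (p, y)) := fun u p => hmeas p _ (hslice u p)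
  have hTc : ∀ u : BoundedContinuousFunction (P × ℝ) ℝ,
      Continuous fun z : P × ℝ => greenOp k (fun y => h z.1 y (u (z.1, y))) z.2 := by
    intro u
    refine continuous_greenOp hk (f := fun p y => h p y (u (p, y))) (hm u) (C := C)
      (fun p y => hC _ _ _) fun y => ?_
    exact (hcont y).comp (f := fun p => (p, u (p, y))) (by fun_prop)
  let T : BoundedContinuousFunction (P × ℝ) ℝ → BoundedContinuousFunction (P × ℝ) ℝ := fun u =>
    BoundedContinuousFunction.ofNormedAddCommGroup _ (hTc u) (C / k ^ 2)
      fun z => abs_greenOp_le hk (hm u z.1) (fun y => hC _ _ _) z.2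
  have hT : ∀ u z, T u z = greenOp k (fun y => h z.1 y (u (z.1, y))) z.2 := fun u z => rfl
  have hctr : ContractingWith (L / k ^ 2).toNNReal T := by
    refine ⟨?_, LipschitzWith.of_dist_le_mul fun u v => ?_⟩
    · rw [← NNReal.coe_lt_coe, Real.coe_toNNReal _ (by positivity)]
      exact (div_lt_one hk2).2 hLk
    · rw [Real.coe_toNNReal _ (by positivity)]
      refine (BoundedContinuousFunction.dist_le (by positivity)).2 fun z => ?_
      rw [Real.dist_eq, hT, hT, greenOp_sub hk (hm u z.1) (hm v z.1) (fun y => hC _ _ _)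
        (fun y => hC _ _ _), div_mul_eq_mul_div]
      refine abs_greenOp_le hk ((hm u z.1).sub (hm v z.1)) (fun y => (hlip' _ _ _ _).trans ?_) z.2
      exact mul_le_mul_of_nonneg_left
        (BoundedContinuousFunction.dist_coe_le_dist (f := u) (g := v) (z.1, y)) hL
  refine ⟨fun p x => hctr.fixedPoint T (p, x), (hctr.fixedPoint T).continuous, fun p => ?_⟩
  funext x
  have := hctr.fixedPoint_isFixedPt (f := T)
  conv_lhs => rw [← this.eq]
  exact hT _ _

/-- The nonlinearity of the model equation, written as `ψ'' = reaction q A B ψ`. -/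
noncomputable def reaction (q A B u : ℝ) : ℝ := A * u ^ (q - 1) - B * u ^ (-q - 1)

theorem hasDerivAt_reaction (q A B : ℝ) {u : ℝ} (hu : 0 < u) :
    HasDerivAt (reaction q A B) ((q - 1) * A * u ^ (q - 2) + (q + 1) * B * u ^ (-q - 2)) u := by
  have h1 := (Real.hasDerivAt_rpow_const (x := u) (p := q - 1) (Or.inl hu.ne')).const_mul A
  have h2 := (Real.hasDerivAt_rpow_const (x := u) (p := -q - 1) (Or.inl hu.ne')).const_mul B
  refine (h1.sub h2).congr_deriv ?_
  rw [show q - 1 - 1 = q - 2 by ring, show -q - 1 - 1 = -q - 2 by ring]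
  ring

theorem continuousOn_reaction {P : Type*} [TopologicalSpace P] {q : ℝ} {A B : P → ℝ}
    (hA : Continuous A) (hB : Continuous B) :
    ContinuousOn (fun z : P × ℝ => reaction q (A z.1) (B z.1) z.2) {z | 0 < z.2} := by
  unfold reaction
  have h : ∀ r : ℝ, ContinuousOn (fun z : P × ℝ => z.2 ^ r) {z | 0 < z.2} := fun r =>
    continuousOn_snd.rpow_const fun z hz => Or.inl (ne_of_gt hz)
  exact ((by fun_prop : Continuous fun z : P × ℝ => A z.1).continuousOn.mul (h _)).sub
    ((by fun_prop : Continuous fun z : P × ℝ => B z.1).continuousOn.mul (h _))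

theorem exists_reaction_slope_bounds {P : Type*} [TopologicalSpace P] [CompactSpace P] {q : ℝ}
    (hq : 2 < q) {A B : P → ℝ} (hA : Continuous A) (hB : Continuous B)
    (hA0 : ∀ p, 0 < A p) (hB0 : ∀ p, 0 ≤ B p) {lo hi : ℝ} (hlo : 0 < lo) :
    ∃ ν > 0, ∃ K, ∀ p, ∀ u ∈ Icc lo hi, ∀ v ∈ Icc lo hi, u ≤ v →
      ν * (v - u) ≤ reaction q (A p) (B p) v - reaction q (A p) (B p) u ∧
      reaction q (A p) (B p) v - reaction q (A p) (B p) u ≤ K * (v - u) := by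
  set D : P × ℝ → ℝ := fun z =>
    (q - 1) * A z.1 * z.2 ^ (q - 2) + (q + 1) * B z.1 * z.2 ^ (-q - 2) with hD
  set S : Set (P × ℝ) := univ ×ˢ Icc lo hi with hS
  have hScomp : IsCompact S := isCompact_univ.prod isCompact_Icc
  have hpos : ∀ z ∈ S, 0 < z.2 := fun z hz => hlo.trans_le hz.2.1
  have hDc : ContinuousOn D S := by
    have h : ∀ r : ℝ, ContinuousOn (fun z : P × ℝ => z.2 ^ r) S := fun r =>
      continuousOn_snd.rpow_const fun z hz => Or.inl (hpos z hz).ne'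
    exact ((by fun_prop : Continuous fun z : P × ℝ => (q - 1) * A z.1).continuousOn.mul (h _)).add
      ((by fun_prop : Continuous fun z : P × ℝ => (q + 1) * B z.1).continuousOn.mul (h _))
  have hDpos : ∀ z ∈ S, 0 < D z := by
    intro z hz
    have h1 := Real.rpow_pos_of_pos (hpos z hz) (q - 2)
    have h2 := Real.rpow_pos_of_pos (hpos z hz) (-q - 2)
    have h3 : 0 < (q - 1) * A z.1 := mul_pos (by linarith) (hA0 _)
    have h4 : 0 ≤ (q + 1) * B z.1 := mul_nonneg (by linarith) (hB0 _)
    simp only [hD]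
    positivity
  obtain ⟨ν, hν, hνD⟩ : ∃ ν > 0, ∀ z ∈ S, ν ≤ D z := by
    rcases S.eq_empty_or_nonempty with he | hne
    · exact ⟨1, one_pos, by simp [he]⟩
    · obtain ⟨z, hz, hmin⟩ := hScomp.exists_isMinOn hne hDc
      exact ⟨D z, hDpos z hz, fun y hy => hmin hy⟩
  obtain ⟨K, hK⟩ := hScomp.bddAbove_image hDc
  refine ⟨ν, hν, K, fun p u hu v hv huv => ?_⟩
  have hder : ∀ x ∈ Icc lo hi, HasDerivAt (reaction q (A p) (B p)) (D (p, x)) x := fun x hx =>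
    hasDerivAt_reaction q (A p) (B p) (hlo.trans_le hx.1)
  have hcon : ContinuousOn (reaction q (A p) (B p)) (Icc lo hi) := fun x hx =>
    (hder x hx).continuousAt.continuousWithinAt
  have hdiff : DifferentiableOn ℝ (reaction q (A p) (B p)) (interior (Icc lo hi)) := fun x hx =>
    (hder x (interior_subset hx)).differentiableAt.differentiableWithinAt
  have hmem : ∀ x ∈ interior (Icc lo hi), (p, x) ∈ S := fun x hx =>
    ⟨mem_univ _, interior_subset hx⟩
  constructor
  · refine (convex_Icc lo hi).mul_sub_le_image_sub_of_le_deriv hcon hdiff (fun x hx => ?_)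
      u hu v hv huv
    rw [(hder x (interior_subset hx)).deriv]
    exact hνD _ (hmem x hx)
  · refine (convex_Icc lo hi).image_sub_le_mul_sub_of_deriv_le hcon hdiff (fun x hx => ?_)
      u hu v hv huv
    rw [(hder x (interior_subset hx)).deriv]
    exact hK (mem_image_of_mem _ (hmem x hx))

theorem lam_eq_or (x : ℝ) : lam x = 1 ∨ lam x = -1 := by
  unfold lam
  split_ifs <;> simp

theorem lam_add_two_pi (x : ℝ) : lam (x + 2 * Real.pi) = lam x := by
  simp [lam, Real.sin_add_two_pi]

theorem continuousAt_lam {x : ℝ} (hx : ∀ j : ℤ, x ≠ j * Real.pi) : ContinuousAt lam x := by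
  have hne : Real.sin x ≠ 0 := fun h => by
    obtain ⟨j, hj⟩ := Real.sin_eq_zero_iff.1 h
    exact hx j hj.symm
  rcases lt_or_gt_of_ne hne with h | h
  · refine (continuousAt_const (y := (-1 : ℝ))).congr ?_
    filter_upwards [Real.continuous_sin.continuousAt.eventually_lt continuousAt_const h] with y hy
    simp [lam, not_lt.2 hy.le]
  · refine (continuousAt_const (y := (1 : ℝ))).congr ?_
    filter_upwards [continuousAt_const.eventually_lt Real.continuous_sin.continuousAt h] with y hy
    simp [lam, hy]

/-- Continuous families of periodic solutions of `ψ'' = reaction q A B ψ`, for coefficients that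
are constant on each half period, given a smooth lower barrier `w` and constant upper barriers. -/
theorem exists_periodic_family {P : Type*} [TopologicalSpace P] [FirstCountableTopology P]
    [CompactSpace P] {q : ℝ} (hq : 2 < q) {A B : P → ℝ → ℝ} (hA : ∀ s, Continuous fun p => A p s)
    (hB : ∀ s, Continuous fun p => B p s) (hA0 : ∀ p x, 0 < A p (lam x))
    (hB0 : ∀ p x, 0 ≤ B p (lam x)) {lo hi : ℝ} (hlo : 0 < lo)
    {w w' w'' : ℝ → ℝ} (hw : ∀ x, HasDerivAt w (w' x) x) (hw' : ∀ x, HasDerivAt w' (w'' x) x)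
    (hc : Continuous w'') (hper : Function.Periodic w (2 * Real.pi)) {Cw : ℝ}
    (hCw : ∀ x, |w'' x| ≤ Cw)
    (hwI : ∀ x, w x ∈ Icc lo hi)
    (hwsub : ∀ p x, reaction q (A p (lam x)) (B p (lam x)) (w x) ≤ w'' x) {M : P → ℝ}
    (hMI : ∀ p, M p ∈ Icc lo hi)
    (hM : ∀ p x, 0 ≤ reaction q (A p (lam x)) (B p (lam x)) (M p)) :
    ∃ Ψ : P → ℝ → ℝ, (Continuous fun z : P × ℝ => Ψ z.1 z.2) ∧ ∀ p,
      Function.Periodic (Ψ p) (2 * Real.pi) ∧ (∀ x, 0 < Ψ p x) ∧ (∀ x, Ψ p x ≤ M p) ∧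
      (∀ c ∈ Icc lo hi, (∀ x, reaction q (A p (lam x)) (B p (lam x)) c ≤ 0) → ∀ x, c ≤ Ψ p x) ∧
      ContDiff ℝ 1 (Ψ p) ∧ ∀ x, (∀ j : ℤ, x ≠ j * Real.pi) →
        HasDerivAt (deriv (Ψ p)) (reaction q (A p (lam x)) (B p (lam x)) (Ψ p x)) x := by
  have hlohi : lo ≤ hi := (hwI 0).1.trans (hwI 0).2
  have hlamp : lam (Real.pi / 2) = 1 := by simp [lam]
  have hlamm : lam (-(Real.pi / 2)) = -1 := by simp [lam]
  obtain ⟨ν₁, hν₁, K₁, h₁⟩ := exists_reaction_slope_bounds hq (hA 1) (hB 1)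
    (fun p => hlamp ▸ hA0 p _) (fun p => hlamp ▸ hB0 p _) hlo (hi := hi)
  obtain ⟨ν₂, hν₂, K₂, h₂⟩ := exists_reaction_slope_bounds hq (hA (-1)) (hB (-1))
    (fun p => hlamm ▸ hA0 p _) (fun p => hlamm ▸ hB0 p _) hlo (hi := hi)
  set ν := min ν₁ ν₂
  have hν : 0 < ν := lt_min hν₁ hν₂
  set K := max ν (max K₁ K₂)
  have hνK : ν ≤ K := le_max_left _ _
  have hK : 0 < K := hν.trans_le hνK
  have hslope : ∀ p x, ∀ u ∈ Icc lo hi, ∀ v ∈ Icc lo hi, u ≤ v →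
      ν * (v - u) ≤ reaction q (A p (lam x)) (B p (lam x)) v -
        reaction q (A p (lam x)) (B p (lam x)) u ∧
      reaction q (A p (lam x)) (B p (lam x)) v - reaction q (A p (lam x)) (B p (lam x)) u
        ≤ K * (v - u) := by
    intro p x u hu v hv huv
    have huv' := sub_nonneg.2 huv
    rcases lam_eq_or x with h | h <;> rw [h]
    · obtain ⟨h3, h4⟩ := h₁ p u hu v hv huv
      exact ⟨(mul_le_mul_of_nonneg_right (min_le_left _ _) huv').trans h3,
        h4.trans (mul_le_mul_of_nonneg_right ((le_max_left _ _).trans (le_max_right _ _)) huv')⟩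
    · obtain ⟨h3, h4⟩ := h₂ p u hu v hv huv
      exact ⟨(mul_le_mul_of_nonneg_right (min_le_right _ _) huv').trans h3,
        h4.trans (mul_le_mul_of_nonneg_right ((le_max_right _ _).trans (le_max_right _ _)) huv')⟩
  set k := √K with hkdef
  have hk : 0 < k := Real.sqrt_pos.2 hK
  have hk2 : k ^ 2 = K := Real.sq_sqrt hK.le
  set cl : ℝ → ℝ := fun u => max lo (min u hi) with hcl
  have hclI : ∀ u, cl u ∈ Icc lo hi := fun u => ⟨le_max_left _ _, max_le hlohi (min_le_right _ _)⟩
  have hcl_eq : ∀ u ∈ Icc lo hi, cl u = u := fun u hu => by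
    simp [hcl, hu.1, hu.2]
  have hclc : Continuous cl := by fun_prop
  set h : P → ℝ → ℝ → ℝ := fun p x u =>
    K * cl u - reaction q (A p (lam x)) (B p (lam x)) (cl u) with hh
  have hlip : ∀ p x u v, h p x u - h p x v ≤ (K - ν) * max 0 (u - v) := by
    intro p x u v
    rcases le_total u v with huv | huv
    · have hle : cl u ≤ cl v := max_le_max le_rfl (min_le_min huv le_rfl)
      have h1 := (hslope p x _ (hclI u) _ (hclI v) hle).2
      rw [max_eq_left (sub_nonpos.2 huv)]
      simp only [hh]
      linarith
    · have hle : cl v ≤ cl u := max_le_max le_rfl (min_le_min huv le_rfl)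
      have h1 := (hslope p x _ (hclI v) _ (hclI u) hle).1
      have h2 : cl u - cl v ≤ u - v := by
        simp only [hcl]
        rcases le_total u hi with h3 | h3 <;> rcases le_total v hi with h4 | h4 <;>
          rcases le_total u lo with h5 | h5 <;> rcases le_total v lo with h6 | h6 <;>
          simp only [min_eq_left, min_eq_right, max_eq_left, max_eq_right, *] <;> linarith
      rw [max_eq_right (sub_nonneg.2 huv)]
      have h3 : (K - ν) * (cl u - cl v) ≤ (K - ν) * (u - v) :=
        mul_le_mul_of_nonneg_left h2 (by linarith)
      simp only [hh]
      linarith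
  have hcontr : ∀ s, Continuous fun z : P × ℝ => reaction q (A z.1 s) (B z.1 s) (cl z.2) := by
    intro s
    exact (continuousOn_reaction (hA s) (hB s)).comp_continuous
      (f := fun z : P × ℝ => (z.1, cl z.2)) (by fun_prop) fun z => hlo.trans_le (hclI z.2).1
  have hcont : ∀ x, Continuous fun z : P × ℝ => h z.1 x z.2 := fun x =>
    Continuous.sub (by fun_prop) (hcontr (lam x))
  have hC : ∃ C, ∀ p x u, |h p x u| ≤ C := by
    have hb : ∀ s, ∃ C, ∀ p u, |reaction q (A p s) (B p s) (cl u)| ≤ C := by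
      intro s
      obtain ⟨C, hC⟩ := (isCompact_univ.prod (isCompact_Icc (a := lo) (b := hi))).exists_bound_of_continuousOn
        (hcontr s).continuousOn
      refine ⟨C, fun p u => ?_⟩
      have := hC (p, cl u) ⟨mem_univ _, hclI u⟩
      simpa [hcl_eq _ (hclI u)] using this
    obtain ⟨C₁, hC₁⟩ := hb 1
    obtain ⟨C₂, hC₂⟩ := hb (-1)
    refine ⟨K * hi + max C₁ C₂, fun p x u => (abs_sub _ _).trans (add_le_add ?_ ?_)⟩
    · rw [abs_of_nonneg (mul_nonneg hK.le (hlo.le.trans (hclI u).1))]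
      exact mul_le_mul_of_nonneg_left (hclI u).2 hK.le
    · rcases lam_eq_or x with hx | hx <;> rw [hx]
      · exact (hC₁ p u).trans (le_max_left _ _)
      · exact (hC₂ p u).trans (le_max_right _ _)
  obtain ⟨C, hC⟩ := hC
  have hmeas : ∀ p (φ : ℝ → ℝ), Continuous φ → Measurable fun x => h p x (φ x) := by
    intro p φ hφ
    have hAm : Measurable fun x => A p (lam x) := by
      have : (fun x => A p (lam x)) = fun x => if 0 < Real.sin x then A p 1 else A p (-1) := by
        funext x; unfold lam; split_ifs <;> rfl
      rw [this]
      exact Measurable.ite (measurableSet_lt measurable_const Real.measurable_sin)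
        measurable_const measurable_const
    have hBm : Measurable fun x => B p (lam x) := by
      have : (fun x => B p (lam x)) = fun x => if 0 < Real.sin x then B p 1 else B p (-1) := by
        funext x; unfold lam; split_ifs <;> rfl
      rw [this]
      exact Measurable.ite (measurableSet_lt measurable_const Real.measurable_sin)
        measurable_const measurable_const
    have hcm : Measurable fun x => cl (φ x) := (hclc.comp hφ).measurable
    simp only [hh, reaction]
    exact (hcm.const_mul K).sub ((hAm.mul (hcm.pow_const _)).sub (hBm.mul (hcm.pow_const _)))
  obtain ⟨Ψ, hΨc, hΨ⟩ := exists_greenOp_fixed_family hk (sub_nonneg.2 hνK)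
    (by rw [hk2]; linarith) hlip hC hmeas hcont
  have hΨp : ∀ p, Continuous (Ψ p) := fun p =>
    hΨc.comp (f := fun x => (p, x)) (by fun_prop)
  have hΨm : ∀ p, Measurable fun y => h p y (Ψ p y) := fun p => hmeas p _ (hΨp p)
  have hcmp : ∀ {f g : ℝ → ℝ}, Measurable f → Measurable g → ∀ {D}, (∀ y, |f y| ≤ D) →
      (∀ y, |g y| ≤ D) →
      (∀ y, f y - g y ≤ (K - ν) * max 0 (greenOp k f y - greenOp k g y)) →
      ∀ x, greenOp k f x ≤ greenOp k g x := fun hf hg _ hfD hgD hfg =>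
    greenOp_comparison hk hf hg hfD hgD (sub_nonneg.2 hνK) (by rw [hk2]; linarith) hfg
  have hconst : ∀ c x, greenOp k (fun _ => K * c) x = c := fun c x => by
    rw [greenOp_const hk, hk2]; field_simp
  have hlow : ∀ p x, w x ≤ Ψ p x := by
    intro p x
    have hcw : Continuous w := continuous_iff_continuousAt.2 fun x => (hw x).continuousAt
    have hCw' : ∀ x, |k ^ 2 * w x - w'' x| ≤ K * hi + Cw := fun x => by
      refine (abs_sub _ _).trans (add_le_add ?_ (hCw x))
      rw [hk2, abs_of_nonneg (mul_nonneg hK.le (hlo.le.trans (hwI x).1))]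
      exact mul_le_mul_of_nonneg_left (hwI x).2 hK.le
    have hgw := greenOp_of_periodic hk hw hw' hc Real.two_pi_pos hper hCw'
    have := hcmp (f := fun y => k ^ 2 * w y - w'' y) (g := fun y => h p y (Ψ p y))
      (by fun_prop) (hΨm p) (D := max (K * hi + Cw) C)
      (fun y => (hCw' y).trans (le_max_left _ _)) (fun y => (hC _ _ _).trans (le_max_right _ _))
      (fun y => ?_) x
    · rwa [hgw, ← hΨ] at this
    · rw [hgw, ← hΨ]
      refine le_trans ?_ (hlip p y (w y) (Ψ p y))
      have := hwsub p y
      simp only [hh, hcl_eq _ (hwI y), hk2]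
      linarith
  have hup : ∀ p x, Ψ p x ≤ M p := by
    intro p x
    have := hcmp (f := fun y => h p y (Ψ p y)) (g := fun _ => K * M p) (hΨm p) measurable_const
      (D := max C |K * M p|) (fun y => (hC _ _ _).trans (le_max_left _ _))
      (fun y => le_max_right _ _) (fun y => ?_) x
    · rwa [hconst, ← hΨ] at this
    · rw [hconst, ← hΨ]
      refine le_trans ?_ (hlip p y (Ψ p y) (M p))
      have := hM p y
      simp only [hh, hcl_eq _ (hMI p)]
      linarith
  have hΨI : ∀ p x, Ψ p x ∈ Icc lo hi := fun p x =>
    ⟨(hwI x).1.trans (hlow p x), (hup p x).trans (hMI p).2⟩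
  refine ⟨Ψ, hΨc, fun p => ⟨?_, fun x => hlo.trans_le (hΨI p x).1, hup p, ?_, ?_⟩⟩
  · have hperh : ∀ y u, h p (y + 2 * Real.pi) u = h p y u := fun y u => by
      simp only [hh, lam_add_two_pi]
    have hshift : ∀ x, Ψ p (x + 2 * Real.pi) =
        greenOp k (fun y => h p y (Ψ p (y + 2 * Real.pi))) x := fun x => by
      conv_lhs => rw [hΨ p]
      rw [greenOp_add_right]
      simp only [hperh]
    have hm' : Measurable fun y => h p y (Ψ p (y + 2 * Real.pi)) :=
      hmeas p _ ((hΨp p).comp (by fun_prop))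
    intro x
    refine le_antisymm ?_ ?_
    · have := hcmp hm' (hΨm p) (fun y => hC _ _ _) (fun y => hC _ _ _) (fun y => ?_) x
      · rwa [← hshift, ← hΨ] at this
      · rw [← hshift, ← hΨ]
        exact hlip _ _ _ _
    · have := hcmp (hΨm p) hm' (fun y => hC _ _ _) (fun y => hC _ _ _) (fun y => ?_) x
      · rwa [← hshift, ← hΨ] at this
      · rw [← hshift, ← hΨ]
        exact hlip _ _ _ _
  · intro c hcI hcr x
    have := hcmp (f := fun _ => K * c) (g := fun y => h p y (Ψ p y)) measurable_const (hΨm p)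
      (D := max |K * c| C) (fun y => le_max_left _ _)
      (fun y => (hC _ _ _).trans (le_max_right _ _)) (fun y => ?_) x
    · rwa [hconst, ← hΨ] at this
    · rw [hconst, ← hΨ]
      refine le_trans ?_ (hlip p y c (Ψ p y))
      have := hcr y
      simp only [hh, hcl_eq _ hcI]
      linarith
  · have hcount : (range fun j : ℤ => (j : ℝ) * Real.pi).Countable := countable_range _
    have hcat : ∀ x ∉ range (fun j : ℤ => (j : ℝ) * Real.pi),
        ContinuousAt (fun y => h p y (Ψ p y)) x := by
      intro x hx
      have hlx := continuousAt_lam (x := x) fun j hj => hx ⟨j, hj.symm⟩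
      have hev : ∀ᶠ y in 𝓝 x, lam y = lam x := by
        have h2 := hlx.eventually (Metric.ball_mem_nhds (lam x) one_pos)
        filter_upwards [h2] with y hy
        rw [Real.dist_eq] at hy
        rcases lam_eq_or x with h3 | h3 <;> rcases lam_eq_or y with h4 | h4 <;>
          rw [h3, h4] at hy ⊢ <;> norm_num at hy
      have h3 : ContinuousAt (fun y => h p x (Ψ p y)) x :=
        ((hcont x).comp (f := fun y => (p, Ψ p y))
          (continuous_const.prodMk (hΨp p))).continuousAt
      refine h3.congr ?_
      filter_upwards [hev] with y hy
      simp only [hh, hy]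
    obtain ⟨v, hv, hvd, hvd'⟩ := exists_deriv_greenOp hk (hΨm p) (fun y => hC _ _ _) hcount hcat
    rw [← hΨ] at hvd hvd'
    have hdv : deriv (Ψ p) = v := funext fun x => (hvd x).deriv
    refine ⟨contDiff_one_iff_deriv.2 ⟨fun x => (hvd x).differentiableAt, hdv ▸ hv⟩,
      fun x hx => ?_⟩
    rw [hdv]
    refine (hvd' x fun ⟨j, hj⟩ => hx j hj.symm).congr_deriv ?_
    simp only [hh, hcl_eq _ (hΨI p x), hk2]
    ring

/-- A small smooth positive lower barrier, available as soon as the singular coefficient is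
bounded below on one of the two half periods. -/
theorem exists_lower_barrier {q : ℝ} (hq : 2 < q) {Amax δ : ℝ} (hδ : 0 < δ)
    {s₀ : ℝ} (hs₀ : s₀ = 1 ∨ s₀ = -1) :
    ∃ σ > 0, ∃ w w' w'' : ℝ → ℝ, (∀ x, HasDerivAt w (w' x) x) ∧ (∀ x, HasDerivAt w' (w'' x) x) ∧
      Continuous w'' ∧ Function.Periodic w (2 * Real.pi) ∧ (∀ x, |w'' x| ≤ 2 * σ) ∧
      (∀ x, w x ∈ Icc σ (5 * σ)) ∧
      ∀ A B : ℝ → ℝ, (∀ x, 0 ≤ A (lam x) ∧ A (lam x) ≤ Amax) → (∀ x, 0 ≤ B (lam x)) →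
        δ ≤ B s₀ → ∀ x, reaction q (A (lam x)) (B (lam x)) (w x) ≤ w'' x := by
  obtain ⟨τ, hτ, hτ1, hτδ, hτA⟩ : ∃ τ > 0, τ ≤ 1 ∧ τ ≤ δ ∧ 10 * Amax * τ ^ (q - 2) ≤ 1 := by
    have h1 : Tendsto (fun τ : ℝ => 10 * Amax * τ ^ (q - 2)) (𝓝[>] 0) (𝓝 0) := by
      have : Continuous fun τ : ℝ => 10 * Amax * τ ^ (q - 2) :=
        continuous_const.mul (Real.continuous_rpow_const (by linarith))
      have h2 := this.tendsto 0
      rw [Real.zero_rpow (by linarith), mul_zero] at h2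
      exact h2.mono_left nhdsWithin_le_nhds
    have hτ1 : ∀ᶠ τ : ℝ in 𝓝[>] 0, τ ≤ 1 := nhdsWithin_le_nhds (Iic_mem_nhds one_pos)
    have hτδ : ∀ᶠ τ : ℝ in 𝓝[>] 0, τ ≤ δ := nhdsWithin_le_nhds (Iic_mem_nhds hδ)
    obtain ⟨τ, h⟩ := ((h1.eventually (Iic_mem_nhds one_pos)).and
      (hτ1.and (hτδ.and self_mem_nhdsWithin))).exists
    exact ⟨τ, h.2.2.2, h.2.1, h.2.2.1, h.1⟩
  set σ := τ / 5 with hσ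
  have hs2 : s₀ ^ 2 = 1 := by rcases hs₀ with h | h <;> rw [h] <;> norm_num
  have hbd : ∀ x, -1 ≤ s₀ * Real.sin x ∧ s₀ * Real.sin x ≤ 1 := fun x => by
    have h1 := Real.neg_one_le_sin x
    have h2 := Real.sin_le_one x
    rcases hs₀ with h | h <;> rw [h] <;> constructor <;> linarith
  refine ⟨σ, by positivity, fun x => σ * (3 + s₀ * Real.sin x - Real.cos (2 * x) / 8),
    fun x => σ * (s₀ * Real.cos x + Real.sin (2 * x) / 4),
    fun x => σ * (-(s₀ * Real.sin x) + Real.cos (2 * x) / 2), fun x => ?_, fun x => ?_,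
    by fun_prop, fun x => ?_, fun x => ?_, fun x => ?_, ?_⟩
  · have h2 : HasDerivAt (fun x => Real.cos (2 * x)) (-Real.sin (2 * x) * 2) x := by
      simpa using ((hasDerivAt_id x).const_mul 2).cos
    refine (((((Real.hasDerivAt_sin x).const_mul s₀).const_add 3).sub
      (h2.div_const 8)).const_mul σ).congr_deriv ?_
    ring
  · have h2 : HasDerivAt (fun x => Real.sin (2 * x)) (Real.cos (2 * x) * 2) x := by
      simpa using ((hasDerivAt_id x).const_mul 2).sin
    refine ((((Real.hasDerivAt_cos x).const_mul s₀).add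
      (h2.div_const 4)).const_mul σ).congr_deriv ?_
    ring
  · simp only
    rw [Real.sin_add_two_pi, show 2 * (x + 2 * Real.pi) = 2 * x + 2 * Real.pi + 2 * Real.pi by ring,
      Real.cos_add_two_pi, Real.cos_add_two_pi]
  · have h1 := hbd x
    have h2 := Real.neg_one_le_cos (2 * x)
    have h3 := Real.cos_le_one (2 * x)
    have hσ0 : 0 < σ := by positivity
    rw [abs_le]
    constructor <;> nlinarith
  · have h1 := hbd x
    have h2 := Real.neg_one_le_cos (2 * x)
    have h3 := Real.cos_le_one (2 * x)
    have hσ0 : 0 < σ := by positivity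
    constructor <;> nlinarith
  · intro A B hA hB hδB x
    have h1 := hbd x
    have h2 := Real.neg_one_le_cos (2 * x)
    have h3 := Real.cos_le_one (2 * x)
    have hσ0 : 0 < σ := by positivity
    set W := σ * (3 + s₀ * Real.sin x - Real.cos (2 * x) / 8) with hW
    have hWσ : σ ≤ W := by nlinarith
    have hWτ : W ≤ τ := by
      have : W ≤ 5 * σ := by nlinarith
      linarith
    have hW0 : 0 < W := hσ0.trans_le hWσ
    have hAmax : 0 ≤ Amax := (hA 0).1.trans (hA 0).2
    have hAW : A (lam x) * W ^ (q - 1) ≤ τ / 10 := by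
      calc A (lam x) * W ^ (q - 1) ≤ Amax * τ ^ (q - 1) := by
            gcongr
            · exact (hA x).2
            · linarith
        _ = Amax * τ ^ (q - 2) * τ := by
            rw [show q - 1 = (q - 2) + 1 by ring, Real.rpow_add hτ, Real.rpow_one, mul_assoc]
        _ ≤ 1 / 10 * τ := by
            gcongr
            linarith
        _ = τ / 10 := by ring
    unfold reaction
    have hWn : 0 < W ^ (-q - 1) := Real.rpow_pos_of_pos hW0 _
    by_cases hx : lam x = s₀
    · have h4 : 1 ≤ W ^ (-q - 1) :=
        Real.one_le_rpow_of_pos_of_le_one_of_nonpos hW0 (hWτ.trans hτ1) (by linarith)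
      have h5 : δ ≤ B (lam x) * W ^ (-q - 1) := by
        rw [hx]
        nlinarith
      nlinarith
    · have h4 : s₀ * Real.sin x ≤ 0 := by
        unfold lam at hx
        rcases hs₀ with h | h <;> rw [h] at hx ⊢ <;> split_ifs at hx with h6
        · exact absurd rfl hx
        · linarith
        · linarith
        · exact absurd rfl hx
      have h5 : Real.cos (2 * x) = 1 - 2 * (s₀ * Real.sin x) ^ 2 := by
        rw [Real.cos_two_mul, Real.cos_sq', mul_pow, hs2]
        ring
      have h6 := mul_nonneg (hB x) hWn.le
      have h7 : 1 / 2 ≤ -(s₀ * Real.sin x) + Real.cos (2 * x) / 2 := by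
        rw [h5]
        nlinarith
      nlinarith

/-- Conservation of energy on an interval of length `π` where the coefficients are constant: the
first integral is small whenever the coefficient `a` of the second derivative is. -/
theorem abs_energy_le {q a α β M c : ℝ} (hq : 0 < q) (ha : 0 < a) (hα : 0 < α) (hβ : 0 < β)
    {ψ : ℝ → ℝ} (hψ : ContDiff ℝ 1 ψ) (hpos : ∀ x, 0 < ψ x) (hM : ∀ x, ψ x ≤ M)
    (hode : ∀ x ∈ Ioo c (c + Real.pi),
      HasDerivAt (deriv ψ) (reaction q (α ^ 2 / a) (β ^ 2 / a) (ψ x)) x)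
    {x : ℝ} (hx : x ∈ Icc c (c + Real.pi)) :
    |a * q / 2 * deriv ψ x ^ 2 - (α * ψ x ^ q - β) ^ 2 / ψ x ^ q|
      ≤ a * q * M ^ 2 / 2 + a ^ 2 * M ^ 4 / (α * β) := by
  have hπ := Real.pi_gt_three
  have hd : ∀ x, HasDerivAt ψ (deriv ψ x) x := fun x =>
    (hψ.differentiable one_ne_zero x).hasDerivAt
  have hdc : Continuous (deriv ψ) := hψ.continuous_deriv_one
  have hψc := hψ.continuous
  have hM0 : 0 < M := (hpos 0).trans_le (hM 0)
  have hyp : ∀ x, 0 < ψ x ^ q := fun x => Real.rpow_pos_of_pos (hpos x) q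
  set F : ℝ → ℝ := fun x => a * q / 2 * deriv ψ x ^ 2 - (α * ψ x ^ q - β) ^ 2 / ψ x ^ q with hF
  set G : ℝ → ℝ := fun x =>
    a * q / 2 * deriv ψ x ^ 2 - α ^ 2 * ψ x ^ q - β ^ 2 * ψ x ^ (-q) with hG
  have hFG : ∀ x, F x = G x + 2 * α * β := fun x => by
    have := hyp x
    simp only [hF, hG, Real.rpow_neg (hpos x).le]
    field_simp
    ring
  have hGc : Continuous G := by
    have h : ∀ r : ℝ, Continuous fun x => ψ x ^ r := fun r =>
      hψc.rpow_const fun x => Or.inl (hpos x).ne'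
    exact (((hdc.pow 2).const_mul _).sub ((h q).const_mul _)).sub ((h (-q)).const_mul _)
  have hGd : ∀ x ∈ Ioo c (c + Real.pi), HasDerivAt G 0 x := fun x hx => by
    have h1 := (hd x).rpow_const (p := q) (Or.inl (hpos x).ne')
    have h2 := (hd x).rpow_const (p := -q) (Or.inl (hpos x).ne')
    refine (((((hode x hx).pow 2).const_mul (a * q / 2)).sub (h1.const_mul (α ^ 2))).sub
      (h2.const_mul (β ^ 2))).congr_deriv ?_
    unfold reaction
    field_simp
    ring
  have hconst : ∀ u ∈ Icc c (c + Real.pi), ∀ v ∈ Icc c (c + Real.pi), u < v → F u = F v := by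
    intro u hu v hv huv
    obtain ⟨z, -, hz⟩ := exists_hasDerivAt_eq_slope G 0 huv hGc.continuousOn
      fun z hz => hGd z ⟨hu.1.trans_lt hz.1, hz.2.trans_le hv.2⟩
    rw [Pi.zero_apply, eq_comm, div_eq_zero_iff] at hz
    rw [hFG, hFG]
    rcases hz with hz | hz <;> linarith
  have hFeq : ∀ u ∈ Icc c (c + Real.pi), F x = F u := fun u hu => by
    rcases lt_trichotomy x u with h | h | h
    · exact hconst x hx u hu h
    · rw [h]
    · exact (hconst u hu x hx h).symm
  have hslope : ∀ b, ∃ z ∈ Ioo b (b + Real.pi / 3), |deriv ψ z| ≤ M := fun b => by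
    obtain ⟨z, hz, hz'⟩ := exists_hasDerivAt_eq_slope ψ (deriv ψ)
      (show b < b + Real.pi / 3 by linarith) hψc.continuousOn fun z _ => hd z
    refine ⟨z, hz, ?_⟩
    rw [hz', add_sub_cancel_left, abs_div, abs_of_pos (show 0 < Real.pi / 3 by linarith),
      div_le_iff₀ (by linarith), abs_le]
    have h1 := hpos b
    have h2 := hM b
    have h3 := hpos (b + Real.pi / 3)
    have h4 := hM (b + Real.pi / 3)
    constructor <;> nlinarith
  obtain ⟨x₁, hx₁, hd₁⟩ := hslope c
  obtain ⟨x₂, hx₂, hd₂⟩ := hslope (c + 2 * Real.pi / 3)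
  have hx₁' : x₁ ∈ Icc c (c + Real.pi) := ⟨hx₁.1.le, by linarith [hx₁.2]⟩
  obtain ⟨x₃, hx₃, hd₃⟩ := exists_hasDerivAt_eq_slope (deriv ψ)
    (fun x => reaction q (α ^ 2 / a) (β ^ 2 / a) (ψ x))
    (show x₁ < x₂ by linarith [hx₁.2, hx₂.1]) hdc.continuousOn fun z hz =>
      hode z ⟨hx₁.1.trans hz.1, by linarith [hz.2, hx₂.2]⟩
  have hx₃' : x₃ ∈ Icc c (c + Real.pi) :=
    ⟨(hx₁.1.trans hx₃.1).le, by linarith [hx₃.2, hx₂.2]⟩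
  have hr : |reaction q (α ^ 2 / a) (β ^ 2 / a) (ψ x₃)| ≤ 2 * M := by
    have h1 : 1 ≤ x₂ - x₁ := by linarith [hx₁.2, hx₂.1]
    rw [hd₃, abs_div, abs_of_pos (show 0 < x₂ - x₁ by linarith), div_le_iff₀ (by linarith)]
    have h2 := abs_sub (deriv ψ x₂) (deriv ψ x₁)
    nlinarith
  have hV : (α * ψ x₃ ^ q - β) ^ 2 / ψ x₃ ^ q ≤ a ^ 2 * M ^ 4 / (α * β) := by
    set r := reaction q (α ^ 2 / a) (β ^ 2 / a) (ψ x₃) with hrdef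
    set u := ψ x₃ with hu
    have hu0 : 0 < u := hpos x₃
    set y := u ^ q with hy
    have hy0 : 0 < y := hyp x₃
    have h1 : (α * y - β) * (α * y + β) = a * (r * u) * y := by
      have e1 : u ^ (q - 1) = y / u := by rw [Real.rpow_sub_one hu0.ne']
      have e2 : u ^ (-q - 1) = 1 / (y * u) := by
        rw [Real.rpow_sub_one hu0.ne', Real.rpow_neg hu0.le, ← hy]; field_simp
      rw [hrdef, reaction, e1, e2]
      field_simp
      ring
    have h2 : |r * u| ≤ 2 * M ^ 2 := by
      rw [abs_mul, abs_of_pos hu0]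
      have := hM x₃
      nlinarith [abs_nonneg r]
    have h3 : (r * u) ^ 2 ≤ 4 * M ^ 4 := by
      have := sq_le_sq' (abs_le.1 h2).1 (abs_le.1 h2).2
      linarith
    have h4 : (α * y - β) ^ 2 * (4 * α * β * y) ≤ (a * y) ^ 2 * (4 * M ^ 4) := by
      calc (α * y - β) ^ 2 * (4 * α * β * y) ≤ (α * y - β) ^ 2 * (α * y + β) ^ 2 := by
            gcongr
            nlinarith [sq_nonneg (α * y - β)]
        _ = (a * y) ^ 2 * (r * u) ^ 2 := by rw [← mul_pow, h1]; ring
        _ ≤ _ := by gcongr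
    rw [div_le_div_iff₀ hy0 (by positivity)]
    refine le_of_mul_le_mul_right ?_ (show 0 < 4 * y by positivity)
    linarith
  change |F x| ≤ _
  rw [abs_le]
  constructor
  · rw [hFeq x₃ hx₃']
    have h1 : 0 ≤ a * q / 2 * deriv ψ x₃ ^ 2 := by positivity
    have h2 : 0 ≤ a * q * M ^ 2 / 2 := by positivity
    simp only [hF]
    linarith
  · rw [hFeq x₁ hx₁']
    have h1 : 0 ≤ (α * ψ x₁ ^ q - β) ^ 2 / ψ x₁ ^ q := div_nonneg (sq_nonneg _) (hyp _).le
    have h2 : 0 ≤ a ^ 2 * M ^ 4 / (α * β) := by positivity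
    have h3 : deriv ψ x₁ ^ 2 ≤ M ^ 2 := sq_le_sq' (abs_le.1 hd₁).1 (abs_le.1 hd₁).2
    have h4 : a * q / 2 * deriv ψ x₁ ^ 2 ≤ a * q / 2 * M ^ 2 := by gcongr
    simp only [hF]
    linarith

theorem limit_energy_ne {t γ e y : ℝ} (hγ : -1 < γ ∧ γ < 1) (he0 : 0 < e) (he : e < 1)
    (ht : |t| ≠ 1) (hy : 1 ≤ y)
    (hmax : y ≤ max (e * (1 + γ) / |t + 1|) (e * (1 - γ) / |t - 1|)) :
    (|t + 1| * y - e * (1 + γ)) ^ 2 ≠ (|t - 1| * y - e * (1 - γ)) ^ 2 := by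
  intro h
  have h1 := mul_pos he0 (show 0 < 1 - γ by linarith)
  have h2 := mul_pos he0 (show 0 < 1 + γ by linarith)
  rcases lt_or_gt_of_ne ht with h3 | h3
  · obtain ⟨h4, h5⟩ := abs_lt.1 h3
    rw [abs_of_pos (show 0 < t + 1 by linarith), abs_of_neg (show t - 1 < 0 by linarith)] at h hmax
    rcases sq_eq_sq_iff_eq_or_eq_neg.1 h with h6 | h6
    · have h7 : t * y = e * γ := by linarith
      rcases le_max_iff.1 hmax with h8 | h8
      · rw [le_div_iff₀ (by linarith)] at h8
        linarith
      · rw [le_div_iff₀ (by linarith)] at h8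
        linarith
    · linarith
  · rcases lt_abs.1 h3 with h4 | h4
    · rw [abs_of_pos (show 0 < t + 1 by linarith), abs_of_pos (show 0 < t - 1 by linarith)] at h
      rcases sq_eq_sq_iff_eq_or_eq_neg.1 h with h6 | h6
      · have : y = e * γ := by linarith
        linarith
      · have : t * y = e := by linarith
        nlinarith
    · rw [abs_of_neg (show t + 1 < 0 by linarith), abs_of_neg (show t - 1 < 0 by linarith)] at h
      rcases sq_eq_sq_iff_eq_or_eq_neg.1 h with h6 | h6
      · have : y = -(e * γ) := by linarith
        linarith
      · have : -t * y = e := by linarith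
        nlinarith

theorem exists_energy_gap {t γ e k q : ℝ} (hγ : -1 < γ ∧ γ < 1) (he0 : 0 < e) (he : e < 1)
    (ht : |t| ≠ 1) (hk : 0 < k) (hq : 0 < q) {a β₁ β₂ : ℝ → ℝ} (ha : Continuous a) (ha0 : a 0 = 0)
    (hβ₁ : Continuous β₁) (hβ₂ : Continuous β₂) (hβ₁0 : β₁ 0 = k * (e * (1 + γ)))
    (hβ₂0 : β₂ 0 = k * (e * (1 - γ))) :
    ∃ z > 0, 0 < β₁ z ∧ 0 < β₂ z ∧ ∀ y M, 1 ≤ y → y ≤ M ^ q →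
      M = max (β₁ z / (k * |t + 1|)) (β₂ z / (k * |t - 1|)) ^ (1 / q) →
      y * ((a z * q * M ^ 2 / 2 + a z ^ 2 * M ^ 4 / (k * |t + 1| * β₁ z)) +
        (a z * q * M ^ 2 / 2 + a z ^ 2 * M ^ 4 / (k * |t - 1| * β₂ z))) <
      |(k * |t + 1| * y - β₁ z) ^ 2 - (k * |t - 1| * y - β₂ z) ^ 2| := by
  have hα₁ : 0 < k * |t + 1| := mul_pos hk <| abs_pos.2 fun h => ht <| by
    rw [eq_neg_of_add_eq_zero_left h]; simp
  have hα₂ : 0 < k * |t - 1| := mul_pos hk <| abs_pos.2 fun h => ht <| by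
    rw [sub_eq_zero.1 h]; simp
  set α₁ := k * |t + 1| with hα₁d
  set α₂ := k * |t - 1| with hα₂d
  have hb₁ : 0 < β₁ 0 := by
    rw [hβ₁0]; exact mul_pos hk (mul_pos he0 (by linarith))
  have hb₂ : 0 < β₂ 0 := by
    rw [hβ₂0]; exact mul_pos hk (mul_pos he0 (by linarith))
  set m : ℝ → ℝ := fun z => max (β₁ z / α₁) (β₂ z / α₂) with hm
  have hmc : Continuous m := (hβ₁.div_const _).max (hβ₂.div_const _)
  set M : ℝ → ℝ := fun z => m z ^ (1 / q) with hMd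
  have hMc : Continuous M := hmc.rpow_const fun z => Or.inr (by positivity)
  set R : ℝ → ℝ := fun z => (a z * q * M z ^ 2 / 2 + a z ^ 2 * M z ^ 4 / (α₁ * β₁ z)) +
        (a z * q * M z ^ 2 / 2 + a z ^ 2 * M z ^ 4 / (α₂ * β₂ z)) with hR
  have hR0 : R 0 = 0 := by simp [hR, ha0]
  have hRc : ContinuousAt R 0 := by
    have h1 : Continuous fun z => a z * q * M z ^ 2 / 2 := by fun_prop
    have h2 : ∀ {α : ℝ} {β : ℝ → ℝ}, 0 < α → Continuous β → 0 < β 0 →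
        ContinuousAt (fun z => a z ^ 2 * M z ^ 4 / (α * β z)) 0 := fun hα hβ hb =>
      ContinuousAt.div (by fun_prop) (by fun_prop) (mul_pos hα hb).ne'
    exact (h1.continuousAt.add (h2 hα₁ hβ₁ hb₁)).add (h1.continuousAt.add (h2 hα₂ hβ₂ hb₂))
  have hgood : ∀ᶠ z in 𝓝 (0 : ℝ), 0 < β₁ z ∧ 0 < β₂ z ∧ m z < m 0 + 1 :=
    (hβ₁.continuousAt.eventually (Ioi_mem_nhds hb₁)).and
      ((hβ₂.continuousAt.eventually (Ioi_mem_nhds hb₂)).and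
        (hmc.continuousAt.eventually (Iio_mem_nhds (lt_add_one _))))
  have hz0 : Tendsto (fun i : ℕ => 1 / ((i : ℝ) + 1)) atTop (𝓝 0) :=
    tendsto_one_div_add_atTop_nhds_zero_nat
  obtain ⟨N, hN⟩ := eventually_atTop.1 (hz0.eventually hgood)
  set z : ℕ → ℝ := fun i => 1 / (((i + N : ℕ) : ℝ) + 1) with hz
  have hz0' : Tendsto z atTop (𝓝 0) := hz0.comp (tendsto_add_atTop_nat N)
  have hzg : ∀ i, 0 < β₁ (z i) ∧ 0 < β₂ (z i) ∧ m (z i) < m 0 + 1 := fun i =>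
    hN _ (Nat.le_add_left _ _)
  by_contra! hcon
  have hex : ∀ i, ∃ y, 1 ≤ y ∧ y ≤ m (z i) ∧
      |(α₁ * y - β₁ (z i)) ^ 2 - (α₂ * y - β₂ (z i)) ^ 2| ≤ y * R (z i) := fun i => by
    obtain ⟨y, M', h1, h2, rfl, h4⟩ := hcon (z i) (by positivity) (hzg i).1 (hzg i).2.1
    refine ⟨y, h1, ?_, h4⟩
    have h0 : 0 ≤ m (z i) := le_max_of_le_left (div_pos (hzg i).1 hα₁).le
    change y ≤ (m (z i) ^ (1 / q)) ^ q at h2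
    rwa [← Real.rpow_mul h0, one_div_mul_cancel hq.ne', Real.rpow_one] at h2
  choose y hy1 hym hyR using hex
  obtain ⟨y₀, -, φ, hφ, hlim⟩ := (isCompact_Icc (a := 1) (b := m 0 + 1)).tendsto_subseq
    (x := y) fun i => ⟨hy1 i, (hym i).trans (hzg i).2.2.le⟩
  have hzφ : Tendsto (z ∘ φ) atTop (𝓝 0) := hz0'.comp hφ.tendsto_atTop
  have L1 : 1 ≤ y₀ := ge_of_tendsto' hlim fun i => hy1 _
  have L2 : y₀ ≤ m 0 :=
    le_of_tendsto_of_tendsto' hlim ((hmc.tendsto 0).comp hzφ) fun i => hym _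
  have hb1 := (hβ₁.tendsto 0).comp hzφ
  have hb2 := (hβ₂.tendsto 0).comp hzφ
  have L3 : |(α₁ * y₀ - β₁ 0) ^ 2 - (α₂ * y₀ - β₂ 0) ^ 2| ≤ y₀ * R 0 :=
    le_of_tendsto_of_tendsto' (((((hlim.const_mul α₁).sub hb1).pow 2).sub
      (((hlim.const_mul α₂).sub hb2).pow 2)).abs) (hlim.mul (hRc.tendsto.comp hzφ))
      fun i => hyR _
  rw [hR0, mul_zero, abs_nonpos_iff, sub_eq_zero, hβ₁0, hβ₂0] at L3
  refine limit_energy_ne hγ he0 he ht L1 ?_ ?_ (y := y₀)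
  · simpa only [hm, hβ₁0, hβ₂0, hα₁d, hα₂d, mul_div_mul_left _ _ hk.ne'] using L2
  · have h5 : k ^ 2 * (|t + 1| * y₀ - e * (1 + γ)) ^ 2 =
        k ^ 2 * (|t - 1| * y₀ - e * (1 - γ)) ^ 2 := by
      rw [← mul_pow, ← mul_pow]
      convert L3 using 2 <;> simp only [hα₁d, hα₂d] <;> ring
    exact mul_left_cancel₀ (by positivity) h5

theorem reaction_eq_div (q A B : ℝ) {u : ℝ} (hu : 0 < u) :
    reaction q A B u = (A * (u ^ q) ^ 2 - B) / (u ^ q * u) := by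
  have hy : 0 < u ^ q := Real.rpow_pos_of_pos hu q
  rw [reaction, Real.rpow_sub_one hu.ne', Real.rpow_sub_one hu.ne', Real.rpow_neg hu.le]
  field_simp

theorem reaction_nonneg {q a α β u : ℝ} (ha : 0 < a) (hβ : 0 ≤ β) (hu : 0 < u)
    (h : β ≤ α * u ^ q) : 0 ≤ reaction q (α ^ 2 / a) (β ^ 2 / a) u := by
  have hy : 0 < u ^ q := Real.rpow_pos_of_pos hu q
  rw [reaction_eq_div q _ _ hu, show α ^ 2 / a * (u ^ q) ^ 2 - β ^ 2 / a =
    ((α * u ^ q) ^ 2 - β ^ 2) / a by ring]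
  have := pow_le_pow_left₀ hβ h 2
  exact div_nonneg (div_nonneg (sub_nonneg.2 this) ha.le) (by positivity)

theorem lam_eq_one {x : ℝ} (h : 0 < Real.sin x) : lam x = 1 := if_pos h

theorem lam_eq_neg_one {x : ℝ} (h : Real.sin x < 0) : lam x = -1 := if_neg h.not_gt

theorem ne_int_mul_pi_of_sin_ne_zero {x : ℝ} (h : Real.sin x ≠ 0) (j : ℤ) : x ≠ j * Real.pi := by
  rintro rfl
  exact h (Real.sin_int_mul_pi j)

/-- The energy identities on both half periods, compared at the origin. -/
theorem abs_energy_jump_le {q a M : ℝ} {α β : ℝ → ℝ} (hq : 0 < q) (ha : 0 < a)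
    (hα : ∀ x, 0 < α (lam x)) (hβ₁ : 0 < β 1) (hβ₂ : 0 < β (-1)) {ψ : ℝ → ℝ}
    (hψ : ContDiff ℝ 1 ψ) (hpos : ∀ x, 0 < ψ x) (hM : ∀ x, ψ x ≤ M)
    (hode : ∀ x, (∀ j : ℤ, x ≠ j * Real.pi) →
      HasDerivAt (deriv ψ) (reaction q (α (lam x) ^ 2 / a) (β (lam x) ^ 2 / a) (ψ x)) x) :
    |(α 1 * ψ 0 ^ q - β 1) ^ 2 - (α (-1) * ψ 0 ^ q - β (-1)) ^ 2| ≤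
      ψ 0 ^ q * ((a * q * M ^ 2 / 2 + a ^ 2 * M ^ 4 / (α 1 * β 1)) +
        (a * q * M ^ 2 / 2 + a ^ 2 * M ^ 4 / (α (-1) * β (-1)))) := by
  have hπ := Real.pi_pos
  have hα₁ : 0 < α 1 := by simpa [lam] using hα (Real.pi / 2)
  have hα₂ : 0 < α (-1) := by
    simpa only [lam_eq_neg_one (x := -(Real.pi / 2)) (by simp)] using hα (-(Real.pi / 2))
  have h1 := abs_energy_le hq ha hα₁ hβ₁ hψ hpos hM (c := 0) (x := 0) (fun x hx => by
    have hs : 0 < Real.sin x := Real.sin_pos_of_pos_of_lt_pi hx.1 (by linarith [hx.2])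
    simpa only [lam_eq_one hs] using hode x (ne_int_mul_pi_of_sin_ne_zero hs.ne'))
    ⟨le_rfl, by linarith⟩
  have h2 := abs_energy_le hq ha hα₂ hβ₂ hψ hpos hM (c := -Real.pi) (x := 0) (fun x hx => by
    have hs : Real.sin x < 0 := Real.sin_neg_of_neg_of_neg_pi_lt (by linarith [hx.2]) hx.1
    simpa only [lam_eq_neg_one hs] using hode x (ne_int_mul_pi_of_sin_ne_zero hs.ne))
    ⟨by linarith, by linarith⟩
  have hy : 0 < ψ 0 ^ q := Real.rpow_pos_of_pos (hpos 0) q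
  set y := ψ 0 ^ q
  set R₁ := a * q * M ^ 2 / 2 + a ^ 2 * M ^ 4 / (α 1 * β 1)
  set R₂ := a * q * M ^ 2 / 2 + a ^ 2 * M ^ 4 / (α (-1) * β (-1))
  have h3 : (α 1 * y - β 1) ^ 2 - (α (-1) * y - β (-1)) ^ 2 =
      y * ((a * q / 2 * deriv ψ 0 ^ 2 - (α (-1) * y - β (-1)) ^ 2 / y) -
        (a * q / 2 * deriv ψ 0 ^ 2 - (α 1 * y - β 1) ^ 2 / y)) := by
    field_simp
    ring
  rw [h3, abs_mul, abs_of_pos hy]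
  refine mul_le_mul_of_nonneg_left ((abs_sub _ _).trans ?_) hy.le
  linarith

theorem exists_pos_forall_le_of_compact {P : Type*} [TopologicalSpace P] [CompactSpace P]
    {f : P → ℝ} (hf : Continuous f) (h0 : ∀ p, 0 < f p) : ∃ δ > 0, ∀ p, δ ≤ f p := by
  rcases isEmpty_or_nonempty P with h | h
  · exact ⟨1, one_pos, fun p => h.elim p⟩
  · obtain ⟨p, -, hp⟩ := isCompact_univ.exists_isMinOn univ_nonempty hf.continuousOn
    exact ⟨f p, h0 p, fun r => hp (mem_univ r)⟩

theorem exists_forall_le_of_compact {P : Type*} [TopologicalSpace P] [CompactSpace P]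
    {f : P → ℝ} (hf : Continuous f) : ∃ C, ∀ p, f p ≤ C := by
  obtain ⟨C, hC⟩ := (isCompact_range hf).bddAbove
  exact ⟨C, fun p => hC (mem_range_self p)⟩

/-- Beyond some parameter value the singular coefficient dominates. -/
theorem exists_singular_coeff_ge {κ t γ η μ e : ℝ} (hκ : 0 < κ) (hγ : -1 < γ ∧ γ < 1)
    (he0 : 0 < e) (he : e < 1) (hTT : η ≠ 0 ∨ μ ≠ 0) (z₁ : ℝ) :
    ∃ z ≥ z₁, ∀ x, κ * (t + lam x) ^ 2 ≤ 2 * η ^ 2 * z ^ 2 + κ * (e * (γ + lam x) + μ * z) ^ 2 := by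
  have hT : ∀ x, |t + lam x| ≤ |t| + 1 := fun x => (abs_add_le _ _).trans <| by
    rcases lam_eq_or x with h | h <;> simp [h]
  have hT2 : ∀ x, (t + lam x) ^ 2 ≤ (|t| + 1) ^ 2 := fun x => by
    rw [← sq_abs (t + lam x)]
    exact pow_le_pow_left₀ (abs_nonneg _) (hT x) 2
  rcases hTT with h | h
  · refine ⟨max z₁ (√κ * (|t| + 1) / |η|), le_max_left _ _, fun x => ?_⟩
    set z := max z₁ (√κ * (|t| + 1) / |η|)
    have h1 : √κ * (|t| + 1) ≤ z * |η| := (div_le_iff₀ (abs_pos.2 h)).1 (le_max_right _ _)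
    have h2 : κ * (|t| + 1) ^ 2 ≤ z ^ 2 * η ^ 2 := by
      have := pow_le_pow_left₀ (by positivity) h1 2
      rwa [mul_pow, mul_pow, Real.sq_sqrt hκ.le, sq_abs η] at this
    have h3 := mul_le_mul_of_nonneg_left (hT2 x) hκ.le
    have h4 : 0 ≤ κ * (e * (γ + lam x) + μ * z) ^ 2 := by positivity
    have h5 : 0 ≤ z ^ 2 * η ^ 2 := by positivity
    linarith
  · refine ⟨max z₁ ((|t| + 3) / |μ|), le_max_left _ _, fun x => ?_⟩
    set z := max z₁ ((|t| + 3) / |μ|)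
    have h1 : |t| + 3 ≤ z * |μ| := (div_le_iff₀ (abs_pos.2 h)).1 (le_max_right _ _)
    have hz : z * |μ| ≤ |μ * z| := by
      rw [abs_mul, mul_comm]
      exact mul_le_mul_of_nonneg_left (le_abs_self z) (abs_nonneg _)
    have h2 : |e * (γ + lam x)| ≤ 2 := by
      rw [abs_le]
      rcases lam_eq_or x with h | h <;> rw [h] <;> constructor <;> nlinarith
    have h3 : |t + lam x| ≤ |e * (γ + lam x) + μ * z| := by
      have h4 := abs_sub_abs_le_abs_sub (μ * z) (-(e * (γ + lam x)))
      rw [abs_neg, sub_neg_eq_add, add_comm (μ * z)] at h4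
      linarith [hT x]
    have h5 := mul_le_mul_of_nonneg_left (sq_le_sq.2 h3) hκ.le
    have h6 : 0 ≤ 2 * η ^ 2 * z ^ 2 := by positivity
    linarith

/-- Solvability for one parameter value `z`, which stands for `d ^ (-q)`. -/
theorem exists_reaction_solution {q κ t γ η μ e : ℝ} (hq : 2 < q) (hκ : 0 < κ)
    (hγ : -1 < γ ∧ γ < 1) (he0 : 0 < e) (he : e < 1) (ht : |t| ≠ 1) (hTT : η ≠ 0 ∨ μ ≠ 0)
    {a : ℝ → ℝ} (ha : Continuous a) (ha0 : a 0 = 0) (hapos : ∀ z, 0 < z → 0 < a z) :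
    ∃ z > 0, ∃ ψ : ℝ → ℝ, Function.Periodic ψ (2 * Real.pi) ∧ (∀ x, 0 < ψ x) ∧
      ContDiff ℝ 1 ψ ∧ ψ 0 = 1 ∧ ∀ x, (∀ j : ℤ, x ≠ j * Real.pi) →
        HasDerivAt (deriv ψ) (reaction q (κ * (t + lam x) ^ 2 / a z)
          ((2 * η ^ 2 * z ^ 2 + κ * (e * (γ + lam x) + μ * z) ^ 2) / a z) (ψ x)) x := by
  have hq0 : 0 < q := by linarith
  have hk : 0 < √κ := Real.sqrt_pos.2 hκ
  have hk2 : √κ ^ 2 = κ := Real.sq_sqrt hκ.le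
  obtain ⟨α, hα⟩ : ∃ α : ℝ → ℝ, ∀ s, α s = √κ * |t + s| := ⟨_, fun s => rfl⟩
  obtain ⟨β, hβ⟩ : ∃ β : ℝ → ℝ → ℝ, ∀ s z,
    β s z = √(2 * η ^ 2 * z ^ 2 + κ * (e * (γ + s) + μ * z) ^ 2) := ⟨_, fun s z => rfl⟩
  have hα2 : ∀ s, α s ^ 2 = κ * (t + s) ^ 2 := fun s => by rw [hα, mul_pow, hk2, sq_abs]
  have hβ2 : ∀ s z, β s z ^ 2 = 2 * η ^ 2 * z ^ 2 + κ * (e * (γ + s) + μ * z) ^ 2 := fun s z => by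
    rw [hβ, Real.sq_sqrt (by positivity)]
  have hβ0 : ∀ s z, 0 ≤ β s z := fun s z => by rw [hβ]; exact Real.sqrt_nonneg _
  have hβc : ∀ s, Continuous (β s) := fun s => by
    rw [funext (hβ s)]
    fun_prop
  have hβz : ∀ s, β s 0 = √κ * (e * |γ + s|) := fun s => by
    rw [hβ, show 2 * η ^ 2 * (0 : ℝ) ^ 2 + κ * (e * (γ + s) + μ * 0) ^ 2 =
      κ * (e * (γ + s)) ^ 2 by ring, Real.sqrt_mul hκ.le, Real.sqrt_sq_eq_abs, abs_mul,
      abs_of_pos he0]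
  have hα₁ : 0 < α 1 := by
    rw [hα]
    exact mul_pos hk (abs_pos.2 fun h => ht (by rw [eq_neg_of_add_eq_zero_left h]; simp))
  have hα₂ : 0 < α (-1) := by
    rw [hα]
    exact mul_pos hk (abs_pos.2 fun h => ht (by rw [eq_neg_of_add_eq_zero_left h]; simp))
  have hαl : ∀ x, 0 < α (lam x) := fun x => by
    rcases lam_eq_or x with h | h <;> rw [h] <;> assumption
  obtain ⟨z₁, hz₁, hb₁, hb₂, hgap⟩ := exists_energy_gap hγ he0 he ht hk hq0 ha ha0
    (hβc 1) (hβc (-1)) (by rw [hβz, abs_of_pos (by linarith), add_comm γ])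
    (by rw [hβz, abs_of_neg (by linarith)]; ring)
  rw [sub_eq_add_neg t 1, ← hα, ← hα] at hgap
  obtain ⟨z₀, hz₀, hbig⟩ := exists_singular_coeff_ge (t := t) hκ hγ he0 he hTT z₁
  have hP : ∀ p : Icc z₁ z₀, 0 < (p : ℝ) := fun p => hz₁.trans_le p.2.1
  have hap : ∀ p : Icc z₁ z₀, 0 < a p := fun p => hapos _ (hP p)
  have hac : Continuous fun p : Icc z₁ z₀ => a p := ha.comp continuous_subtype_val
  have hAc : ∀ s, Continuous fun p : Icc z₁ z₀ => α s ^ 2 / a p := fun s =>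
    continuous_const.div hac fun p => (hap p).ne'
  have hβcP : ∀ s, Continuous fun p : Icc z₁ z₀ => β s p := fun s =>
    (hβc s).comp continuous_subtype_val
  have hBc : ∀ s, Continuous fun p : Icc z₁ z₀ => β s p ^ 2 / a p := fun s =>
    ((hβcP s).pow 2).div hac fun p => (hap p).ne'
  obtain ⟨s₀, hs₀, hs₀pos⟩ : ∃ s₀ : ℝ, (s₀ = 1 ∨ s₀ = -1) ∧ ∀ z, 0 < z → 0 < β s₀ z := by
    have key : ∀ s z, e * (γ + s) + μ * z ≠ 0 → 0 < β s z := fun s z h => by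
      rw [hβ]
      exact Real.sqrt_pos.2 (by positivity)
    rcases le_total 0 μ with h | h
    · refine ⟨1, Or.inl rfl, fun z hz => key _ _ ?_⟩
      have h1 := mul_pos he0 (show 0 < γ + 1 by linarith)
      have h2 := mul_nonneg h hz.le
      linarith
    · refine ⟨-1, Or.inr rfl, fun z hz => key _ _ ?_⟩
      have h1 := mul_pos he0 (show 0 < -(γ + -1) by linarith)
      have h2 := mul_nonneg (neg_nonneg.2 h) hz.le
      linarith
  obtain ⟨A₁, hA₁⟩ := exists_forall_le_of_compact (hAc 1)
  obtain ⟨A₂, hA₂⟩ := exists_forall_le_of_compact (hAc (-1))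
  obtain ⟨δ, hδ, hδB⟩ := exists_pos_forall_le_of_compact (hBc s₀)
    fun p => div_pos (pow_pos (hs₀pos _ (hP p)) 2) (hap p)
  obtain ⟨σ, hσ, w, w', w'', hw, hw', hw'', hper, hwb, hwI, hwsub⟩ :=
    exists_lower_barrier hq hδ hs₀ (Amax := max A₁ A₂)
  set m : Icc z₁ z₀ → ℝ := fun p => max (β 1 p / α 1) (β (-1) p / α (-1)) with hm
  have hmc : Continuous m := ((hβcP 1).div_const _).max ((hβcP (-1)).div_const _)
  have hm0 : ∀ p, 0 < m p := fun p => by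
    rcases hs₀ with rfl | rfl
    · exact lt_max_of_lt_left (div_pos (hs₀pos _ (hP p)) hα₁)
    · exact lt_max_of_lt_right (div_pos (hs₀pos _ (hP p)) hα₂)
  set M : Icc z₁ z₀ → ℝ := fun p => m p ^ (1 / q) with hM
  have hMc : Continuous M := hmc.rpow_const fun p => Or.inl (hm0 p).ne'
  have hM0 : ∀ p, 0 < M p := fun p => Real.rpow_pos_of_pos (hm0 p) _
  have hMq : ∀ p, M p ^ q = m p := fun p => by
    rw [hM, ← Real.rpow_mul (hm0 p).le, one_div_mul_cancel hq0.ne', Real.rpow_one]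
  obtain ⟨M₁, hM₁, hM₁le⟩ := exists_pos_forall_le_of_compact hMc hM0
  obtain ⟨M₂, hM₂⟩ := exists_forall_le_of_compact hMc
  set lo := min σ (min M₁ 1)
  set hi := max (5 * σ) (max M₂ 1)
  have hlo : 0 < lo := lt_min hσ (lt_min hM₁ one_pos)
  obtain ⟨Ψ, hΨc, hΨ⟩ := exists_periodic_family hq (A := fun (p : Icc z₁ z₀) s => α s ^ 2 / a p)
    (B := fun p s => β s p ^ 2 / a p) hAc hBc
    (fun p x => div_pos (pow_pos (hαl x) 2) (hap p))
    (fun p x => div_nonneg (sq_nonneg _) (hap p).le) hlo (hi := hi) hw hw' hw'' hper hwb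
    (fun x => ⟨(min_le_left _ _).trans (hwI x).1, (hwI x).2.trans (le_max_left _ _)⟩)
    (fun p x => hwsub (fun s => α s ^ 2 / a p) (fun s => β s p ^ 2 / a p)
      (fun x => ⟨div_nonneg (sq_nonneg _) (hap p).le, by
        rcases lam_eq_or x with h | h <;> rw [h]
        · exact (hA₁ p).trans (le_max_left _ _)
        · exact (hA₂ p).trans (le_max_right _ _)⟩)
      (fun x => div_nonneg (sq_nonneg _) (hap p).le) (hδB p) x)
    (M := M) (fun p => ⟨(min_le_right _ _).trans ((min_le_left _ _).trans (hM₁le p)),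
      (hM₂ p).trans ((le_max_left _ _).trans (le_max_right _ _))⟩)
    (fun p x => reaction_nonneg (hap p) (hβ0 _ _) (hM0 p) (by
      rw [hMq, ← div_le_iff₀' (hαl x)]
      rcases lam_eq_or x with h | h <;> rw [h]
      · exact le_max_left _ _
      · exact le_max_right _ _))
  have hbot : ∃ p, Ψ p 0 ≤ 1 := by
    refine ⟨⟨z₁, le_rfl, hz₀⟩, ?_⟩
    by_contra! hgt
    obtain ⟨-, hpos, hle, -, hsm, hode⟩ := hΨ ⟨z₁, le_rfl, hz₀⟩
    refine (hgap _ _ (Real.one_le_rpow hgt.le hq0.le)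
      (Real.rpow_le_rpow (hpos 0).le (hle 0) hq0.le) rfl).not_ge ?_
    exact abs_energy_jump_le (β := fun s => β s z₁) hq0 (hapos _ hz₁) hαl hb₁ hb₂ hsm hpos hle hode
  have htop : ∃ p, 1 ≤ Ψ p 0 := by
    refine ⟨⟨z₀, hz₀, le_rfl⟩, (hΨ _).2.2.2.1 1 ⟨(min_le_right _ _).trans (min_le_right _ _),
      (le_max_right _ _).trans (le_max_right _ _)⟩ (fun x => ?_) 0⟩
    have h1 := hapos z₀ (hz₁.trans_le hz₀)
    simp only [reaction, Real.one_rpow, mul_one, sub_nonpos]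
    rw [hα2, hβ2]
    exact div_le_div_of_nonneg_right (hbig x) h1.le
  have : PreconnectedSpace (Icc z₁ z₀) := Subtype.preconnectedSpace isPreconnected_Icc
  obtain ⟨p, hp⟩ := mem_range_of_exists_le_of_exists_ge
    (hΨc.comp (f := fun p : Icc z₁ z₀ => (p, (0 : ℝ))) (by fun_prop)) hbot htop
  obtain ⟨hper', hpos, -, -, hsm, hode⟩ := hΨ p
  refine ⟨p, hP p, Ψ p, hper', hpos, hsm, hp, fun x hx => ?_⟩
  have := hode x hx
  rwa [hα2, hβ2] at this

end LichnerowiczModel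

/-- Existence for a weakened coupling constant (Section 3.4, first Proposition). -/
theorem weakened_coupling_existence (n : ℕ) (hn : 3 ≤ n) (t γ η μ ε : ℝ)
    (hγ : -1 < γ ∧ γ < 1) (hε : -1 < ε ∧ ε < 0) (ht : |t| ≠ 1)
    (hTT : η ≠ 0 ∨ μ ≠ 0) :
    ∃ d : ℝ, 0 < d ∧ ∃ ψ : ℝ → ℝ, IsPertModelSolution n t γ η μ ε d ψ ∧ ψ 0 = 1 := by
  have hn' : (3 : ℝ) ≤ n := by exact_mod_cast hn
  have hq : 2 < qex n := by
    rw [qex, lt_div_iff₀ (by linarith)]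
    linarith
  have hκ : 0 < kap n := div_pos (by linarith) (by linarith)
  unfold IsPertModelSolution
  generalize qex n = q at hq ⊢
  generalize kap n = κ at hκ ⊢
  have hr : 0 < (q - 2) / q := div_pos (by linarith) (by linarith)
  obtain ⟨z, hz, ψ, hper, hpos, hsm, h0, hode⟩ :=
    LichnerowiczModel.exists_reaction_solution (q := q) hq hκ hγ
      (e := 1 + ε) (by linarith) (by linarith) ht hTT
      (a := fun z => 2 * κ * q * z ^ ((q - 2) / q))
      (continuous_const.mul (Real.continuous_rpow_const hr.le))
      (by rw [Real.zero_rpow hr.ne', mul_zero])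
      (fun z hz => mul_pos (by positivity) (Real.rpow_pos_of_pos hz _))
  have hd : ∀ r : ℝ, (z ^ (-1 / q)) ^ r = z ^ (-1 / q * r) := fun r =>
    (Real.rpow_mul hz.le _ _).symm
  have hd1 : (z ^ (-1 / q)) ^ (-q) = z := by
    rw [hd, show -1 / q * -q = 1 by field_simp, Real.rpow_one]
  have hd2 : (z ^ (-1 / q)) ^ (-(2 * q)) = z ^ 2 := by
    rw [hd, show -1 / q * -(2 * q) = (2 : ℕ) by push_cast; field_simp, Real.rpow_natCast]
  have hd3 : (z ^ (-1 / q)) ^ (-(q - 2)) = z ^ ((q - 2) / q) := by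
    rw [hd, show -1 / q * -(q - 2) = (q - 2) / q by ring]
  refine ⟨z ^ (-1 / q), Real.rpow_pos_of_pos hz _, ψ, ⟨hper, hpos, hsm, fun x hx => ?_⟩, h0⟩
  refine ⟨(hode x hx).differentiableAt, ?_⟩
  rw [(hode x hx).deriv, hd1, hd2, hd3, LichnerowiczModel.reaction]
  have hz' : 0 < z ^ ((q - 2) / q) := Real.rpow_pos_of_pos hz _
  field_simp
  ring
end

section
/- Existence and uniqueness for the Lichnerowicz equation on the circle with bounded coefficients (Proposition 3.6, parts 1 and uniqueness): Let α, β : ℝ → ℝ be 2π-periodic, bounded, measurable functions such that neither α nor β vanishes almost everywhere. Then there exists a function u : ℝ → ℝ that is 2π-periodic, everywhere positive, continuously differentiable with Lipschitz continuous derivative u', and such that for almost every x ∈ ℝ the derivative u''(x) of u' exists at x and satisfies −u''(x) − α(x)² u(x)^{−q−1} + β(x)² u(x)^{q−1} = 0. Moreover u is unique: any two functions with these properties coincide. -/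
open Real MeasureTheory

/-- Bounded measurable real functions. -/
def BddMeas (h : ℝ → ℝ) : Prop := Measurable h ∧ ∃ C : ℝ, ∀ x, |h x| ≤ C

namespace BddMeas

variable {h k : ℝ → ℝ}

theorem add (hh : BddMeas h) (hk : BddMeas k) : BddMeas fun x => h x + k x := by
  obtain ⟨hm, C, hC⟩ := hh
  obtain ⟨km, D, hD⟩ := hk
  exact ⟨hm.add km, C + D, fun x => (abs_add_le _ _).trans (add_le_add (hC x) (hD x))⟩

theorem mul (hh : BddMeas h) (hk : BddMeas k) : BddMeas fun x => h x * k x := by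
  obtain ⟨hm, C, hC⟩ := hh
  obtain ⟨km, D, hD⟩ := hk
  refine ⟨hm.mul km, C * D, fun x => ?_⟩
  rw [abs_mul]
  exact mul_le_mul (hC x) (hD x) (abs_nonneg _) ((abs_nonneg _).trans (hC x))

theorem const (c : ℝ) : BddMeas fun _ => c := ⟨measurable_const, |c|, fun _ => le_rfl⟩

theorem const_mul (hh : BddMeas h) (c : ℝ) : BddMeas fun x => c * h x := (const c).mul hh

theorem sub (hh : BddMeas h) (hk : BddMeas k) : BddMeas fun x => h x - k x := by
  convert hh.add (hk.const_mul (-1)) using 2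
  ring

theorem comp_neg (hh : BddMeas h) : BddMeas fun x => h (-x) :=
  ⟨hh.1.comp measurable_neg, hh.2.imp fun _ hC x => hC (-x)⟩

theorem locallyIntegrable (hh : BddMeas h) : LocallyIntegrable h volume := by
  obtain ⟨C, hC⟩ := hh.2
  exact (locallyIntegrable_const C).mono hh.1.aestronglyMeasurable
    (ae_of_all _ fun x => (hC x).trans (le_abs_self C))

theorem intervalIntegrable (hh : BddMeas h) (x y : ℝ) : IntervalIntegrable h volume x y :=
  intervalIntegrable_iff.2 <|
    (hh.locallyIntegrable.integrableOn_isCompact isCompact_uIcc).mono_set Set.uIoc_subset_uIcc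

end BddMeas

/-- The bounded solution of `v' + μ v = h`. -/
noncomputable def pastAvg (μ : ℝ) (h : ℝ → ℝ) (x : ℝ) : ℝ :=
  ∫ s in Set.Iic x, exp (μ * (s - x)) * h s

section pastAvg

variable {μ : ℝ} {h k : ℝ → ℝ}

theorem integrableOn_exp_mul_sub (hμ : 0 < μ) (x y : ℝ) :
    IntegrableOn (fun s => exp (μ * (s - x))) (Set.Iic y) volume := by
  have := (integrableOn_exp_mul_Iic hμ y).mul_const (exp (-(μ * x)))
  refine this.congr (ae_of_all _ fun s => ?_)
  simp only [← exp_add]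
  ring_nf

theorem BddMeas.integrableOn_exp_mul (hμ : 0 < μ) (hh : BddMeas h) (x y : ℝ) :
    IntegrableOn (fun s => exp (μ * (s - x)) * h s) (Set.Iic y) volume := by
  obtain ⟨hm, C, hC⟩ := hh
  exact (integrableOn_exp_mul_sub hμ x y).mul_bdd (c := C) hm.aestronglyMeasurable
    (ae_of_all _ hC)

theorem pastAvg_mono (hμ : 0 < μ) (hh : BddMeas h) (hk : BddMeas k) (hle : ∀ x, h x ≤ k x)
    (x : ℝ) : pastAvg μ h x ≤ pastAvg μ k x :=
  integral_mono (hh.integrableOn_exp_mul hμ x x) (hk.integrableOn_exp_mul hμ x x) fun s =>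
    mul_le_mul_of_nonneg_left (hle s) (exp_nonneg _)

theorem pastAvg_add (hμ : 0 < μ) (hh : BddMeas h) (hk : BddMeas k) (x : ℝ) :
    pastAvg μ (fun x => h x + k x) x = pastAvg μ h x + pastAvg μ k x := by
  simp only [pastAvg, mul_add]
  exact integral_add (hh.integrableOn_exp_mul hμ x x) (hk.integrableOn_exp_mul hμ x x)

theorem pastAvg_const_mul (c : ℝ) (x : ℝ) :
    pastAvg μ (fun x => c * h x) x = c * pastAvg μ h x := by
  simp only [pastAvg, mul_left_comm _ c]
  exact integral_const_mul _ _

theorem pastAvg_const (hμ : 0 < μ) (c : ℝ) (x : ℝ) : pastAvg μ (fun _ => c) x = c / μ := by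
  have : ∀ s, exp (μ * (s - x)) * c = exp (μ * s) * (exp (-(μ * x)) * c) := fun s => by
    rw [← mul_assoc, ← exp_add]
    ring_nf
  simp only [pastAvg, this]
  rw [integral_mul_const, integral_exp_mul_Iic hμ, exp_neg]
  field_simp

theorem abs_pastAvg_le (hμ : 0 < μ) (hh : BddMeas h) {C : ℝ} (hC : ∀ x, |h x| ≤ C) (x : ℝ) :
    |pastAvg μ h x| ≤ C / μ := by
  rw [abs_le, ← neg_div, ← pastAvg_const hμ (-C) x, ← pastAvg_const hμ C x]
  exact ⟨pastAvg_mono hμ (.const _) hh (fun y => (abs_le.1 (hC y)).1) x,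
    pastAvg_mono hμ hh (.const _) (fun y => (abs_le.1 (hC y)).2) x⟩

theorem pastAvg_periodic {T : ℝ} (hp : ∀ x, h (x + T) = h x) (x : ℝ) :
    pastAvg μ h (x + T) = pastAvg μ h x := by
  have := (measurePreserving_add_right (volume : Measure ℝ) T).setIntegral_preimage_emb
    (measurableEmbedding_addRight T) (fun s => exp (μ * (s - (x + T))) * h s) (Set.Iic (x + T))
  simpa [pastAvg, hp] using this.symm

theorem pastAvg_eq (hμ : 0 < μ) (hh : BddMeas h) (x y : ℝ) :
    pastAvg μ h y = exp (μ * (x - y)) * pastAvg μ h x + ∫ s in x..y, exp (μ * (s - y)) * h s := by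
  rw [← intervalIntegral.integral_Iic_sub_Iic (hh.integrableOn_exp_mul hμ y x)
    (hh.integrableOn_exp_mul hμ y y)]
  have : exp (μ * (x - y)) * pastAvg μ h x = ∫ s in Set.Iic x, exp (μ * (s - y)) * h s := by
    rw [pastAvg, ← integral_const_mul]
    simp only [← mul_assoc, ← exp_add]
    ring_nf
  rw [this, pastAvg]
  ring

theorem pastAvg_eq_exp_mul (hμ : 0 < μ) (hh : BddMeas h) (x : ℝ) :
    pastAvg μ h x = exp (-(μ * x)) * (pastAvg μ h 0 + ∫ s in (0 : ℝ)..x, exp (μ * s) * h s) := by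
  rw [pastAvg_eq hμ hh 0 x, mul_add, ← intervalIntegral.integral_const_mul]
  simp only [← mul_assoc, ← exp_add]
  ring_nf

theorem hasDerivAt_pastAvg_of_integral (hμ : 0 < μ) (hh : BddMeas h) {x : ℝ}
    (hx : HasDerivAt (fun x => ∫ s in (0 : ℝ)..x, exp (μ * s) * h s) (exp (μ * x) * h x) x) :
    HasDerivAt (pastAvg μ h) (h x - μ * pastAvg μ h x) x := by
  have h1 : HasDerivAt (fun x => exp (-(μ * x))) (exp (-(μ * x)) * -(μ * 1)) x :=
    ((hasDerivAt_id x).const_mul μ).neg.exp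
  have h2 := h1.mul (hx.const_add (pastAvg μ h 0))
  rw [show pastAvg μ h = _ from funext (pastAvg_eq_exp_mul hμ hh)]
  refine h2.congr_deriv ?_
  have : exp (-(μ * x)) * exp (μ * x) = 1 := by rw [← exp_add]; simp
  linear_combination h x * this

theorem ae_hasDerivAt_pastAvg (hμ : 0 < μ) (hh : BddMeas h) :
    ∀ᵐ x, HasDerivAt (pastAvg μ h) (h x - μ * pastAvg μ h x) x := by
  have : LocallyIntegrable (fun s => exp (μ * s) * h s) volume := by
    have := hh.locallyIntegrable.continuous_mul (g := fun s => exp (μ * s)) (by fun_prop)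
    exact this
  filter_upwards [LocallyIntegrable.ae_hasDerivAt_integral this] with x hx
  exact hasDerivAt_pastAvg_of_integral hμ hh (hx 0)

theorem hasDerivAt_pastAvg (hμ : 0 < μ) (hh : BddMeas h) (hc : Continuous h) (x : ℝ) :
    HasDerivAt (pastAvg μ h) (h x - μ * pastAvg μ h x) x := by
  have : Continuous fun s => exp (μ * s) * h s := by fun_prop
  exact hasDerivAt_pastAvg_of_integral hμ hh (this.integral_hasStrictDerivAt 0 x).hasDerivAt

theorem lipschitzWith_pastAvg (hμ : 0 < μ) (hh : BddMeas h) :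
    ∃ K : NNReal, LipschitzWith K (pastAvg μ h) := by
  obtain ⟨C, hC⟩ := hh.2
  have hC0 : 0 ≤ C := (abs_nonneg _).trans (hC 0)
  refine ⟨(2 * C).toNNReal, LipschitzWith.of_dist_le_mul fun y x => ?_⟩
  rw [Real.coe_toNNReal _ (by positivity)]
  wlog hxy : x ≤ y generalizing x y
  · rw [dist_comm, dist_comm y x]
    exact this x y (le_of_not_ge hxy)
  have h1 : |∫ s in x..y, exp (μ * (s - y)) * h s| ≤ C * |y - x| := by
    rw [← Real.norm_eq_abs]
    refine intervalIntegral.norm_integral_le_of_norm_le_const fun s hs => ?_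
    rw [Set.uIoc_of_le hxy] at hs
    rw [Real.norm_eq_abs, abs_mul, abs_exp]
    have : exp (μ * (s - y)) ≤ 1 := exp_le_one_iff.2 (by nlinarith [hs.2])
    nlinarith [hC s, exp_pos (μ * (s - y)), abs_nonneg (h s)]
  have h2 := abs_pastAvg_le hμ hh hC x
  have h3 : exp (μ * (x - y)) ≤ 1 := exp_le_one_iff.2 (by nlinarith)
  have h4 := add_one_le_exp (μ * (x - y))
  rw [Real.dist_eq, Real.dist_eq, pastAvg_eq hμ hh x y, abs_of_nonneg (sub_nonneg.2 hxy)]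
  rw [abs_of_nonneg (sub_nonneg.2 hxy)] at h1
  have h5 : |(exp (μ * (x - y)) - 1) * pastAvg μ h x| ≤ (μ * (y - x)) * (C / μ) := by
    rw [abs_mul]
    refine mul_le_mul ?_ h2 (abs_nonneg _) (mul_nonneg hμ.le (sub_nonneg.2 hxy))
    rw [abs_of_nonpos (by linarith)]
    linarith
  have h6 : (μ * (y - x)) * (C / μ) = C * (y - x) := by field_simp
  calc _ = |(exp (μ * (x - y)) - 1) * pastAvg μ h x + ∫ s in x..y, exp (μ * (s - y)) * h s| := by
        congr 1; ring
    _ ≤ _ := by linarith [abs_add_le ((exp (μ * (x - y)) - 1) * pastAvg μ h x)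
                  (∫ s in x..y, exp (μ * (s - y)) * h s)]

theorem bddMeas_pastAvg (hμ : 0 < μ) (hh : BddMeas h) : BddMeas (pastAvg μ h) :=
  ⟨(lipschitzWith_pastAvg hμ hh).choose_spec.continuous.measurable,
    hh.2.choose / μ, abs_pastAvg_le hμ hh hh.2.choose_spec⟩

theorem le_pastAvg_of_periodic (hμ : 0 < μ) (hh : BddMeas h) {T : ℝ} (hT : 0 ≤ T)
    (hp : ∀ x, h (x + T) = h x) (h0 : ∀ x, 0 ≤ h x) (x : ℝ) :
    exp (-(μ * T)) * (∫ s in (0 : ℝ)..T, h s) ≤ pastAvg μ h x := by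
  have h1 := pastAvg_eq hμ hh (x - T) x
  have h2 : 0 ≤ pastAvg μ h (x - T) :=
    integral_nonneg fun s => mul_nonneg (exp_nonneg _) (h0 s)
  have h3 : (∫ s in (x - T)..x, h s) = ∫ s in (0 : ℝ)..T, h s := by
    have : Function.Periodic h T := hp
    simpa using this.intervalIntegral_add_eq (x - T) 0
  have h4 : ∫ s in (x - T)..x, exp (-(μ * T)) * h s ≤
      ∫ s in (x - T)..x, exp (μ * (s - x)) * h s := by
    refine intervalIntegral.integral_mono_on (by linarith)
      ((hh.const_mul _).intervalIntegrable _ _) ?_ fun s hs => ?_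
    · exact (hh.intervalIntegrable _ _).continuousOn_mul (by fun_prop)
    · refine mul_le_mul_of_nonneg_right (exp_le_exp.2 ?_) (h0 s)
      nlinarith [hs.1]
  rw [intervalIntegral.integral_const_mul, h3] at h4
  have := mul_nonneg (exp_nonneg (μ * (x - T - x))) h2
  linarith

end pastAvg

theorem intervalIntegral_pos_of_periodic {d : ℝ → ℝ} (hd : BddMeas d) {T : ℝ} (hT : 0 < T)
    (hp : ∀ x, d (x + T) = d x) (h0 : ∀ x, 0 ≤ d x) (hne : ¬ ∀ᵐ x : ℝ ∂volume, d x = 0) :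
    0 < ∫ s in (0 : ℝ)..T, d s := by
  have hper : Function.Periodic d T := hp
  refine lt_of_le_of_ne (intervalIntegral.integral_nonneg hT.le fun s _ => h0 s) fun hz => hne ?_
  have key : ∀ n : ℤ, ∀ᵐ x ∂volume.restrict (Set.Ioc (n • T) ((n + 1) • T)), d x = 0 := by
    intro n
    have h1 : ∫ s in (n • T)..((n + 1) • T), d s = 0 := by
      rw [add_smul, one_smul, hper.intervalIntegral_add_eq (n • T) 0, zero_add, ← hz]
    have hle : n • T ≤ (n + 1) • T := by rw [add_smul, one_smul]; linarith
    have := (intervalIntegral.integral_eq_zero_iff_of_le_of_nonneg_ae hle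
      (ae_of_all _ h0) (hd.intervalIntegrable _ _)).1 h1
    exact this
  have := (ae_restrict_iUnion_iff _ _).2 key
  rwa [iUnion_Ioc_zsmul hT, Measure.restrict_univ] at this

/-- The bounded solution of `-u'' + μ² u = h`. -/
noncomputable def helmholtzInv (μ : ℝ) (h : ℝ → ℝ) (x : ℝ) : ℝ :=
  pastAvg μ (fun y => pastAvg μ h (-y)) (-x)

/-- `u` is `2π`-periodic and continuously differentiable, its derivative is Lipschitz, and
`u'' = g` almost everywhere. -/
def SolvesPeriodic (g u : ℝ → ℝ) : Prop :=
  (∀ x, u (x + 2 * Real.pi) = u x) ∧ ∃ v : ℝ → ℝ, (∀ x, HasDerivAt u (v x) x) ∧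
    (∃ K : NNReal, LipschitzWith K v) ∧ ∀ᵐ x, HasDerivAt v (g x) x

section helmholtzInv

variable {μ : ℝ} {h k : ℝ → ℝ}

theorem helmholtzInv_mono (hμ : 0 < μ) (hh : BddMeas h) (hk : BddMeas k) (hle : ∀ x, h x ≤ k x)
    (x : ℝ) : helmholtzInv μ h x ≤ helmholtzInv μ k x :=
  pastAvg_mono hμ (bddMeas_pastAvg hμ hh).comp_neg (bddMeas_pastAvg hμ hk).comp_neg
    (fun y => pastAvg_mono hμ hh hk hle (-y)) (-x)

theorem helmholtzInv_add (hμ : 0 < μ) (hh : BddMeas h) (hk : BddMeas k) (x : ℝ) :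
    helmholtzInv μ (fun x => h x + k x) x = helmholtzInv μ h x + helmholtzInv μ k x := by
  simp only [helmholtzInv, pastAvg_add hμ hh hk]
  exact pastAvg_add hμ (bddMeas_pastAvg hμ hh).comp_neg (bddMeas_pastAvg hμ hk).comp_neg (-x)

theorem helmholtzInv_const_mul (c x : ℝ) :
    helmholtzInv μ (fun x => c * h x) x = c * helmholtzInv μ h x := by
  simp only [helmholtzInv, pastAvg_const_mul]

theorem helmholtzInv_const (hμ : 0 < μ) (c x : ℝ) : helmholtzInv μ (fun _ => c) x = c / μ ^ 2 := by
  simp only [helmholtzInv, pastAvg_const hμ]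
  field_simp

theorem le_helmholtzInv_of_periodic (hμ : 0 < μ) (hh : BddMeas h)
    (hp : ∀ x, h (x + 2 * Real.pi) = h x) (h0 : ∀ x, 0 ≤ h x) (x : ℝ) :
    exp (-(μ * (2 * Real.pi))) * (∫ s in (0 : ℝ)..(2 * Real.pi), h s) / μ ≤ helmholtzInv μ h x := by
  rw [← pastAvg_const hμ _ (-x)]
  exact pastAvg_mono hμ (.const _) (bddMeas_pastAvg hμ hh).comp_neg
    (fun y => le_pastAvg_of_periodic hμ hh (by positivity) hp h0 (-y)) (-x)

theorem exists_pos_le_helmholtzInv (hμ : 0 < μ) (hh : BddMeas h)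
    (hp : ∀ x, h (x + 2 * Real.pi) = h x) (h0 : ∀ x, 0 ≤ h x)
    (hne : ¬ ∀ᵐ x : ℝ ∂volume, h x = 0) :
    ∃ κ > 0, ∀ x, κ ≤ helmholtzInv μ h x := by
  have := intervalIntegral_pos_of_periodic hh (by positivity) hp h0 hne
  exact ⟨_, by positivity, le_helmholtzInv_of_periodic hμ hh hp h0⟩

theorem solvesPeriodic_helmholtzInv (hμ : 0 < μ) (hh : BddMeas h)
    (hp : ∀ x, h (x + 2 * Real.pi) = h x) :
    SolvesPeriodic (fun x => μ ^ 2 * helmholtzInv μ h x - h x) (helmholtzInv μ h) := by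
  obtain ⟨K, hK⟩ := lipschitzWith_pastAvg hμ hh
  have hb := (bddMeas_pastAvg hμ hh).comp_neg
  obtain ⟨K', hK'⟩ := lipschitzWith_pastAvg hμ hb
  have hneg : LipschitzWith 1 fun x : ℝ => -x := LipschitzWith.id.neg
  have hder : ∀ x, HasDerivAt (helmholtzInv μ h) (μ * helmholtzInv μ h x - pastAvg μ h x) x := by
    intro x
    have h1 := hasDerivAt_pastAvg hμ hb (hK.continuous.comp continuous_neg) (-x)
    refine (h1.comp x (hasDerivAt_neg x)).congr_deriv ?_
    simp only [helmholtzInv, neg_neg]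
    ring
  refine ⟨fun x => ?_, _, hder, ⟨_, ((lipschitzWith_smul μ).comp (hK'.comp hneg)).sub hK⟩, ?_⟩
  · have := pastAvg_periodic (μ := μ) (h := fun y => pastAvg μ h (-y)) (T := 2 * Real.pi)
      (fun y => ?_) (-(x + 2 * Real.pi))
    · rw [helmholtzInv, ← this, helmholtzInv]
      congr 1
      ring
    · rw [← pastAvg_periodic hp]
      congr 1
      ring
  · filter_upwards [ae_hasDerivAt_pastAvg hμ hh] with x hx
    refine (((hder x).const_mul μ).sub hx).congr_deriv ?_
    ring

end helmholtzInv

theorem BddMeas.of_periodic {u : ℝ → ℝ} (hc : Continuous u)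
    (hp : ∀ x, u (x + 2 * Real.pi) = u x) : BddMeas u := by
  have hper : Function.Periodic u (2 * Real.pi) := hp
  obtain ⟨C, hC⟩ := (hper.compact_of_continuous (by positivity) hc).isBounded.exists_norm_le
  exact ⟨hc.measurable, C, fun x => hC _ ⟨x, rfl⟩⟩

namespace SolvesPeriodic

variable {g₁ g₂ g u₁ u₂ u : ℝ → ℝ}

theorem continuous (hu : SolvesPeriodic g u) : Continuous u := by
  obtain ⟨-, v, hv, -⟩ := hu
  exact continuous_iff_continuousAt.2 fun x => (hv x).continuousAt

theorem bddMeas (hu : SolvesPeriodic g u) : BddMeas u := .of_periodic hu.continuous hu.1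

theorem sub (h₁ : SolvesPeriodic g₁ u₁) (h₂ : SolvesPeriodic g₂ u₂) :
    SolvesPeriodic (fun x => g₁ x - g₂ x) (fun x => u₁ x - u₂ x) := by
  obtain ⟨p₁, v₁, d₁, ⟨K₁, l₁⟩, a₁⟩ := h₁
  obtain ⟨p₂, v₂, d₂, ⟨K₂, l₂⟩, a₂⟩ := h₂
  refine ⟨fun x => by simp only [p₁, p₂], fun x => v₁ x - v₂ x, fun x => (d₁ x).sub (d₂ x),
    ⟨_, l₁.sub l₂⟩, ?_⟩
  filter_upwards [a₁, a₂] with x h h'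
  exact h.sub h'

theorem congr (hu : SolvesPeriodic g₁ u) (hg : ∀ x, g₁ x = g₂ x) : SolvesPeriodic g₂ u := by
  rwa [← funext hg]

theorem const_mul (c : ℝ) (hu : SolvesPeriodic g u) :
    SolvesPeriodic (fun x => c * g x) (fun x => c * u x) := by
  obtain ⟨p, v, d, ⟨K, l⟩, a⟩ := hu
  refine ⟨fun x => by simp only [p], fun x => c * v x, fun x => (d x).const_mul c,
    ⟨_, (lipschitzWith_smul c).comp l⟩, ?_⟩
  filter_upwards [a] with x h
  exact h.const_mul c

/-- A periodic function with `u u'' ≥ 0` is constant. -/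
theorem eq_const_of_mul_nonneg (hu : SolvesPeriodic g u) (h0 : ∀ᵐ x, 0 ≤ u x * g x) :
    (∃ c, ∀ x, u x = c) ∧ ∀ᵐ x, g x = 0 := by
  obtain ⟨hp, v, hd, ⟨K, hK⟩, ha⟩ := hu
  have hvp : Function.Periodic v (2 * Real.pi) := fun x => by
    have h1 : HasDerivAt u (v (x + 2 * Real.pi)) x := by
      have := (hd (x + 2 * Real.pi)).comp_add_const x (2 * Real.pi)
      rwa [show (fun x => u (x + 2 * Real.pi)) = u from funext hp] at this
    exact h1.unique (hd x)
  have hφp : Function.Periodic (fun x => u x * v x) (2 * Real.pi) := fun x => by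
    simp only [hp x, hvp x]
  have hφd : ∀ᵐ x, HasDerivAt (fun x => u x * v x) (v x * v x + u x * g x) x := by
    filter_upwards [ha] with x hx
    exact (hd x).mul hx
  obtain ⟨-, C, hC⟩ := BddMeas.of_periodic hK.continuous hvp
  have hLu : LipschitzWith C.toNNReal u := by
    refine lipschitzWith_of_nnnorm_deriv_le (fun x => (hd x).differentiableAt) fun x => ?_
    rw [(hd x).deriv, ← NNReal.coe_le_coe]
    exact (hC x).trans (Real.le_coe_toNNReal C)
  have hmono : Monotone fun x => u x * v x := by
    intro x y hxy
    have hac : AbsolutelyContinuousOnInterval (fun x => u x * v x) x y :=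
      (hLu.lipschitzOnWith.absolutelyContinuousOnInterval).mul
        (hK.lipschitzOnWith.absolutelyContinuousOnInterval)
    have : 0 ≤ ∫ s in x..y, deriv (fun x => u x * v x) s := by
      refine intervalIntegral.integral_nonneg_of_ae hxy ?_
      filter_upwards [hφd, h0] with s hs hs0
      rw [hs.deriv]
      exact add_nonneg (mul_self_nonneg _) hs0
    rw [hac.integral_deriv_eq_sub] at this
    exact sub_nonneg.1 this
  have hle : ∀ x y, u x * v x ≤ u y * v y := fun x y => by
    obtain ⟨n, hn⟩ := exists_nat_gt ((x - y) / (2 * Real.pi))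
    rw [div_lt_iff₀ (by positivity)] at hn
    have h1 : (fun x => u x * v x) (y + n * (2 * Real.pi)) = u y * v y := hφp.nat_mul n y
    exact (hmono (by linarith : x ≤ y + n * (2 * Real.pi))).trans h1.le
  have hconst : (fun x => u x * v x) = fun _ => u 0 * v 0 :=
    funext fun x => le_antisymm (hle x 0) (hle 0 x)
  have hv0 : v = fun _ => 0 := by
    refine (Continuous.ae_eq_iff_eq volume hK.continuous continuous_const).1 ?_
    filter_upwards [hφd, h0] with x hx hx0
    rw [hconst] at hx
    have := hx.unique (hasDerivAt_const x _)
    nlinarith [mul_self_nonneg (v x)]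
  refine ⟨⟨u 0, fun x => is_const_of_deriv_eq_zero (fun x => (hd x).differentiableAt)
    (fun x => by rw [(hd x).deriv, hv0]) x 0⟩, ?_⟩
  filter_upwards [ha] with x hx
  rw [hv0] at hx
  exact hx.unique (hasDerivAt_const x _)

theorem eq_helmholtzInv {μ : ℝ} (hμ : 0 < μ) (hu : SolvesPeriodic g u) (hg : BddMeas g)
    (hgp : ∀ x, g (x + 2 * Real.pi) = g x) (x : ℝ) :
    u x = helmholtzInv μ (fun x => μ ^ 2 * u x - g x) x := by
  have hz := (hu.sub (solvesPeriodic_helmholtzInv hμ ((hu.bddMeas.const_mul (μ ^ 2)).sub hg)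
    fun x => by simp only [hu.1, hgp])).congr (g₂ := fun x => μ ^ 2 *
      (u x - helmholtzInv μ (fun x => μ ^ 2 * u x - g x) x)) fun x => by ring
  obtain ⟨⟨c, hc⟩, h0⟩ := hz.eq_const_of_mul_nonneg <| ae_of_all _ fun x => by
    rw [mul_left_comm]
    exact mul_nonneg (sq_nonneg _) (mul_self_nonneg _)
  obtain ⟨y, hy⟩ := h0.exists
  rw [hc, mul_eq_zero, or_iff_right (by positivity)] at hy
  exact sub_eq_zero.1 ((hc x).trans hy)

end SolvesPeriodic

/-- A Banach fixed point theorem for `u = (-D² + μ²)⁻¹ (μ² u - F(x, u))`, posed on functions with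
values in the closed sets `I x`. -/
theorem exists_eq_helmholtzInv {μ : ℝ} (hμ : 0 < μ) {F : ℝ → ℝ → ℝ} {d : ℝ → ℝ} {I : ℝ → Set ℝ}
    (hI : ∀ x, IsClosed (I x))
    (hF : ∀ u : ℝ → ℝ, Continuous u → (∀ x, u (x + 2 * Real.pi) = u x) → (∀ x, u x ∈ I x) →
      BddMeas fun x => F x (u x))
    (hFp : ∀ x y, F (x + 2 * Real.pi) y = F x y)
    (hd : BddMeas d) (hdp : ∀ x, d (x + 2 * Real.pi) = d x) (hd0 : ∀ x, 0 ≤ d x)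
    (hdne : ¬ ∀ᵐ x : ℝ ∂volume, d x = 0) (hdμ : ∀ x, d x ≤ μ ^ 2)
    (hmono : ∀ x, ∀ y ∈ I x, ∀ z ∈ I x, y ≤ z →
      d x * (z - y) ≤ F x z - F x y ∧ F x z - F x y ≤ μ ^ 2 * (z - y))
    (hinv : ∀ u : ℝ → ℝ, Continuous u → (∀ x, u (x + 2 * Real.pi) = u x) → (∀ x, u x ∈ I x) →
      ∀ x, helmholtzInv μ (fun x => μ ^ 2 * u x - F x (u x)) x ∈ I x)
    (hne : ∃ u : ℝ → ℝ, Continuous u ∧ (∀ x, u (x + 2 * Real.pi) = u x) ∧ ∀ x, u x ∈ I x) :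
    ∃ u : ℝ → ℝ, Continuous u ∧ (∀ x, u (x + 2 * Real.pi) = u x) ∧ (∀ x, u x ∈ I x) ∧
      ∀ x, u x = helmholtzInv μ (fun x => μ ^ 2 * u x - F x (u x)) x := by
  let S : Set (BoundedContinuousFunction ℝ ℝ) :=
    {f | (∀ x, f (x + 2 * Real.pi) = f x) ∧ ∀ x, f x ∈ I x}
  have hS : IsClosed S := by
    have : S = (⋂ x, {f | f (x + 2 * Real.pi) = f x}) ∩ ⋂ x, {f | f x ∈ I x} := by
      ext f
      simp [S]
    rw [this]
    refine (isClosed_iInter fun x => ?_).inter (isClosed_iInter fun x => ?_)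
    · exact isClosed_eq (continuous_eval_const _)
        (continuous_eval_const _)
    · exact (hI x).preimage (continuous_eval_const x)
  have := hS.completeSpace_coe
  obtain ⟨u₀, hu₀c, hu₀p, hu₀I⟩ := hne
  have mk : ∀ u : ℝ → ℝ, Continuous u → (∀ x, u (x + 2 * Real.pi) = u x) → (∀ x, u x ∈ I x) →
      ∃ f : S, ∀ x, f.1 x = u x := fun u hc hp hu => by
    obtain ⟨C, hC⟩ := (BddMeas.of_periodic hc hp).2
    exact ⟨⟨BoundedContinuousFunction.ofNormedAddCommGroup u hc C hC, hp, hu⟩, fun _ => rfl⟩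
  have : Nonempty S := ⟨(mk u₀ hu₀c hu₀p hu₀I).choose⟩
  have hRb : ∀ f : S, BddMeas fun x => μ ^ 2 * f.1 x - F x (f.1 x) := fun f =>
    ((BddMeas.of_periodic f.1.continuous f.2.1).const_mul _).sub
      (hF _ f.1.continuous f.2.1 f.2.2)
  have hRp : ∀ f : S, ∀ x, μ ^ 2 * f.1 (x + 2 * Real.pi) -
      F (x + 2 * Real.pi) (f.1 (x + 2 * Real.pi)) = μ ^ 2 * f.1 x - F x (f.1 x) := fun f x => by
    rw [f.2.1, hFp]
  choose T hT using fun f : S =>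
    mk (helmholtzInv μ (fun x => μ ^ 2 * f.1 x - F x (f.1 x)))
      (solvesPeriodic_helmholtzInv hμ (hRb f) (hRp f)).continuous
      (solvesPeriodic_helmholtzInv hμ (hRb f) (hRp f)).1
      (hinv _ f.1.continuous f.2.1 f.2.2)
  obtain ⟨κ, hκ, hκd⟩ := exists_pos_le_helmholtzInv hμ hd hdp hd0 hdne
  have hle : ∀ f g : S, ∀ x, (T f).1 x ≤ (T g).1 x + (1 - κ) * dist f g := by
    intro f g x
    set M := dist f g
    have hfg : ∀ y, |f.1 y - g.1 y| ≤ M := fun y =>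
      BoundedContinuousFunction.dist_coe_le_dist (f := f.1) (g := g.1) y
    have key : ∀ y, (μ ^ 2 * f.1 y - F y (f.1 y)) + M * d y ≤
        (μ ^ 2 * g.1 y - F y (g.1 y)) + M * μ ^ 2 := by
      intro y
      have h1 := abs_le.1 (hfg y)
      have h5 := hdμ y
      have h6 : M * d y ≤ M * μ ^ 2 := mul_le_mul_of_nonneg_left h5 dist_nonneg
      rcases le_total (f.1 y) (g.1 y) with hle | hge
      · have := (hmono y _ (f.2.2 y) _ (g.2.2 y) hle).2
        linarith
      · have := (hmono y _ (g.2.2 y) _ (f.2.2 y) hge).1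
        nlinarith [mul_nonneg (sub_nonneg.2 h5) (sub_nonneg.2 h1.2)]
    have h1 := helmholtzInv_mono hμ ((hRb f).add (hd.const_mul M)) ((hRb g).add (.const _)) key x
    rw [helmholtzInv_add hμ (hRb f) (hd.const_mul M), helmholtzInv_add hμ (hRb g) (.const _),
      helmholtzInv_const_mul, helmholtzInv_const hμ, ← hT, ← hT,
      mul_div_cancel_right₀ _ (by positivity)] at h1
    have h2 := mul_le_mul_of_nonneg_left (hκd x) (dist_nonneg : 0 ≤ M)
    linarith
  have hcontr : ContractingWith (1 - κ).toNNReal T := by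
    refine ⟨by simpa using hκ, LipschitzWith.of_dist_le_mul fun f g => ?_⟩
    refine (BoundedContinuousFunction.dist_le (by positivity)).2 fun x => ?_
    have h1 := hle f g x
    have h2 := hle g f x
    have h3 := mul_le_mul_of_nonneg_right (Real.le_coe_toNNReal (1 - κ))
      (dist_nonneg : 0 ≤ dist f g)
    rw [dist_comm g f] at h2
    rw [Real.dist_eq, abs_le]
    constructor <;> linarith
  obtain ⟨f, hf⟩ : ∃ f, T f = f := ⟨_, hcontr.fixedPoint_isFixedPt⟩
  exact ⟨f.1, f.1.continuous, f.2.1, f.2.2, fun x => by rw [← hT, hf]⟩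

theorem exists_rpow_div_slope_bounds {s : ℝ} (hs : s ≠ 0) {m M : ℝ} (hm : 0 < m) (hmM : m ≤ M) :
    ∃ c > 0, ∃ L, ∀ y z, m ≤ y → y ≤ z → z ≤ M →
      c * (z - y) ≤ z ^ s / s - y ^ s / s ∧ z ^ s / s - y ^ s / s ≤ L * (z - y) := by
  have hpos : ∀ y ∈ Set.Icc m M, 0 < y := fun y hy => hm.trans_le hy.1
  have hder : ∀ y ∈ Set.Icc m M, HasDerivAt (fun y => y ^ s / s) (y ^ (s - 1)) y := by
    intro y hy
    refine ((hasDerivAt_rpow_const (Or.inl (hpos y hy).ne')).div_const s).congr_deriv ?_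
    field_simp
  have hcont : ContinuousOn (fun y : ℝ => y ^ (s - 1)) (Set.Icc m M) := fun y hy =>
    (continuousAt_rpow_const _ _ (Or.inl (hpos y hy).ne')).continuousWithinAt
  have hne : (Set.Icc m M).Nonempty := Set.nonempty_Icc.2 hmM
  obtain ⟨a, ha, hamin⟩ := isCompact_Icc.exists_isMinOn hne hcont
  obtain ⟨b, hb, hbmax⟩ := isCompact_Icc.exists_isMaxOn hne hcont
  have hc : ContinuousOn (fun y => y ^ s / s) (Set.Icc m M) := fun y hy =>
    (hder y hy).continuousAt.continuousWithinAt
  have hd : DifferentiableOn ℝ (fun y => y ^ s / s) (interior (Set.Icc m M)) := fun y hy =>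
    (hder y (interior_subset hy)).differentiableAt.differentiableWithinAt
  refine ⟨a ^ (s - 1), rpow_pos_of_pos (hpos a ha) _, b ^ (s - 1), fun y z hy hyz hz => ⟨?_, ?_⟩⟩
  · refine (convex_Icc m M).mul_sub_le_image_sub_of_le_deriv hc hd (fun x hx => ?_) y
      ⟨hy, hyz.trans hz⟩ z ⟨hy.trans hyz, hz⟩ hyz
    rw [(hder x (interior_subset hx)).deriv]
    exact hamin (interior_subset hx)
  · refine (convex_Icc m M).image_sub_le_mul_sub_of_deriv_le hc hd (fun x hx => ?_) y
      ⟨hy, hyz.trans hz⟩ z ⟨hy.trans hyz, hz⟩ hyz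
    rw [(hder x (interior_subset hx)).deriv]
    exact hbmax (interior_subset hx)

theorem exists_pos_solvesPeriodic_linear {a b : ℝ → ℝ} (ha : BddMeas a) (hb : BddMeas b)
    (hap : ∀ x, a (x + 2 * Real.pi) = a x) (hbp : ∀ x, b (x + 2 * Real.pi) = b x)
    (ha0 : ∀ x, 0 ≤ a x) (hb0 : ∀ x, 0 ≤ b x)
    (hane : ¬ ∀ᵐ x : ℝ ∂volume, a x = 0) (hbne : ¬ ∀ᵐ x : ℝ ∂volume, b x = 0) :
    ∃ w : ℝ → ℝ, SolvesPeriodic (fun x => b x * w x - a x) w ∧ ∃ κ > 0, ∀ x, κ ≤ w x := by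
  obtain ⟨B, hB⟩ := hb.2
  set μ := √(max B 1)
  have hμ : 0 < μ := sqrt_pos.2 (lt_max_of_lt_right one_pos)
  have hμ2 : μ ^ 2 = max B 1 := sq_sqrt (le_max_of_le_right zero_le_one)
  have hbμ : ∀ x, b x ≤ μ ^ 2 := fun x => by
    rw [hμ2]
    exact ((le_abs_self _).trans (hB x)).trans (le_max_left _ _)
  have hF : ∀ u : ℝ → ℝ, Continuous u → (∀ x, u (x + 2 * Real.pi) = u x) →
      BddMeas fun x => b x * u x - a x := fun u hc hp =>
    (hb.mul (.of_periodic hc hp)).sub ha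
  obtain ⟨κ, hκ, hκa⟩ := exists_pos_le_helmholtzInv hμ ha hap ha0 hane
  have hlow : ∀ u : ℝ → ℝ, Continuous u → (∀ x, u (x + 2 * Real.pi) = u x) → (∀ x, 0 ≤ u x) →
      ∀ x, κ ≤ helmholtzInv μ (fun x => μ ^ 2 * u x - (b x * u x - a x)) x := by
    intro u hc hp h0 x
    refine (hκa x).trans (helmholtzInv_mono hμ ha
      (((BddMeas.of_periodic hc hp).const_mul _).sub (hF u hc hp)) (fun y => ?_) x)
    nlinarith [mul_nonneg (sub_nonneg.2 (hbμ y)) (h0 y)]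
  obtain ⟨w, hwc, hwp, hw0, hw⟩ := exists_eq_helmholtzInv hμ (F := fun x y => b x * y - a x)
    (d := b) (I := fun _ => Set.Ici 0) (fun _ => isClosed_Ici) (fun u hc hp _ => hF u hc hp)
    (fun x y => by simp only [hap, hbp]) hb hbp hb0 hbne hbμ
    (fun x y _ z _ hyz => ⟨by linarith, by
      nlinarith [mul_nonneg (sub_nonneg.2 (hbμ x)) (sub_nonneg.2 hyz)]⟩)
    (fun u hc hp h0 x => hκ.le.trans (hlow u hc hp h0 x))
    ⟨fun _ => 0, continuous_const, fun _ => rfl, fun _ => Set.mem_Ici.2 le_rfl⟩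
  refine ⟨w, ?_, κ, hκ, fun x => (hlow w hwc hwp hw0 x).trans (hw x).ge⟩
  have hsol := solvesPeriodic_helmholtzInv hμ
    (((BddMeas.of_periodic hwc hwp).const_mul (μ ^ 2)).sub (hF w hwc hwp))
    (fun x => by simp only [hap, hbp, hwp])
  rw [← funext hw] at hsol
  exact hsol.congr fun x => by ring

theorem exists_pos_solvesPeriodic_rpow {a b : ℝ → ℝ} (ha : BddMeas a) (hb : BddMeas b)
    (hap : ∀ x, a (x + 2 * Real.pi) = a x) (hbp : ∀ x, b (x + 2 * Real.pi) = b x)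
    (ha0 : ∀ x, 0 ≤ a x) (hb0 : ∀ x, 0 ≤ b x)
    (hane : ¬ ∀ᵐ x : ℝ ∂volume, a x = 0) (hbne : ¬ ∀ᵐ x : ℝ ∂volume, b x = 0)
    {p s : ℝ} (hp : 1 ≤ p) (hs : s < 0) :
    ∃ u : ℝ → ℝ, SolvesPeriodic (fun x => b x * u x ^ p - a x * u x ^ s) u ∧ ∀ x, 0 < u x := by
  obtain ⟨w, hw, κ, hκ, hκw⟩ := exists_pos_solvesPeriodic_linear ha hb hap hbp ha0 hb0 hane hbne
  obtain ⟨W, hW⟩ := hw.bddMeas.2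
  replace hW : ∀ x, w x ≤ W := fun x => (le_abs_self _).trans (hW x)
  have hκW : κ ≤ W := (hκw 0).trans (hW 0)
  have hWpos : 0 < W := hκ.trans_le hκW
  have hwpos : ∀ x, 0 < w x := fun x => hκ.trans_le (hκw x)
  set ε := min 1 W⁻¹
  set t := max 1 κ⁻¹
  have hε : 0 < ε := lt_min one_pos (inv_pos.2 hWpos)
  have ht : 0 < t := lt_max_of_lt_left one_pos
  have hεt : ε ≤ t := (min_le_left _ _).trans (le_max_left _ _)
  have hε1 : ∀ x, ε * w x ≤ 1 := fun x =>
    (mul_le_mul (min_le_right _ _) (hW x) (hwpos x).le (inv_pos.2 hWpos).le).trans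
      (inv_mul_cancel₀ hWpos.ne').le
  have ht1 : ∀ x, 1 ≤ t * w x := fun x =>
    (inv_mul_cancel₀ hκ.ne').ge.trans (mul_le_mul (le_max_right _ _) (hκw x) hκ.le ht.le)
  have hm : 0 < ε * κ := mul_pos hε hκ
  have hmM : ε * κ ≤ t * W := mul_le_mul hεt hκW hκ.le ht.le
  have hmem : ∀ x y, y ∈ Set.Icc (ε * w x) (t * w x) → ε * κ ≤ y ∧ y ≤ t * W := fun x y hy =>
    ⟨(mul_le_mul_of_nonneg_left (hκw x) hε.le).trans hy.1,
      hy.2.trans (mul_le_mul_of_nonneg_left (hW x) ht.le)⟩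
  have hp0 : 0 < p := by linarith
  obtain ⟨c, hc, L, hL⟩ := exists_rpow_div_slope_bounds hp0.ne' hm hmM
  obtain ⟨c', hc', L', hL'⟩ := exists_rpow_div_slope_bounds hs.ne hm hmM
  obtain ⟨A, hA⟩ := ha.2
  obtain ⟨B, hB⟩ := hb.2
  replace hA : ∀ x, a x ≤ A := fun x => (le_abs_self _).trans (hA x)
  replace hB : ∀ x, b x ≤ B := fun x => (le_abs_self _).trans (hB x)
  have hA0 : 0 ≤ A := (ha0 0).trans (hA 0)
  have hB0 : 0 ≤ B := (hb0 0).trans (hB 0)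
  set Λ := p * B * max c L + -s * A * max 0 L' + 1
  have hΛ : 0 < Λ := by
    have : 0 ≤ p * B * max c L := mul_nonneg (by positivity) (le_max_of_le_left hc.le)
    have : 0 ≤ -s * A * max 0 L' := mul_nonneg (mul_nonneg (by linarith) hA0) (le_max_left _ _)
    positivity
  obtain ⟨μ, hμ, hμ2⟩ : ∃ μ > 0, μ ^ 2 = Λ := ⟨√Λ, sqrt_pos.2 hΛ, sq_sqrt hΛ.le⟩
  have hmono : ∀ x, ∀ y ∈ Set.Icc (ε * w x) (t * w x), ∀ z ∈ Set.Icc (ε * w x) (t * w x), y ≤ z →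
      p * c * b x * (z - y) ≤ (b x * z ^ p - a x * z ^ s) - (b x * y ^ p - a x * y ^ s) ∧
      (b x * z ^ p - a x * z ^ s) - (b x * y ^ p - a x * y ^ s) ≤ μ ^ 2 * (z - y) := by
    intro x y hy z hz hyz
    obtain ⟨h1, h2⟩ := hL y z (hmem x y hy).1 hyz (hmem x z hz).2
    obtain ⟨h3, h4⟩ := hL' y z (hmem x y hy).1 hyz (hmem x z hz).2
    have hzy := sub_nonneg.2 hyz
    have hsplit : (b x * z ^ p - a x * z ^ s) - (b x * y ^ p - a x * y ^ s) =
        p * b x * (z ^ p / p - y ^ p / p) + -s * a x * (z ^ s / s - y ^ s / s) := by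
      field_simp [hs.ne]
      ring
    have hpb : 0 ≤ p * b x := mul_nonneg hp0.le (hb0 x)
    have hsa : 0 ≤ -s * a x := mul_nonneg (by linarith) (ha0 x)
    rw [hsplit, hμ2]
    constructor
    · have h5 := mul_le_mul_of_nonneg_left h1 hpb
      have h6 := mul_nonneg hsa ((mul_nonneg hc'.le hzy).trans h3)
      linarith
    · have h5 : p * b x * (z ^ p / p - y ^ p / p) ≤ p * B * (max c L * (z - y)) :=
        mul_le_mul (mul_le_mul_of_nonneg_left (hB x) hp0.le)
          (h2.trans (mul_le_mul_of_nonneg_right (le_max_right _ _) hzy))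
          ((mul_nonneg hc.le hzy).trans h1) (by positivity)
      have h6 : -s * a x * (z ^ s / s - y ^ s / s) ≤ -s * A * (max 0 L' * (z - y)) :=
        mul_le_mul (mul_le_mul_of_nonneg_left (hA x) (by linarith))
          (h4.trans (mul_le_mul_of_nonneg_right (le_max_right _ _) hzy))
          ((mul_nonneg hc'.le hzy).trans h3) (mul_nonneg (by linarith) hA0)
      simp only [Λ]
      linarith
  have hwlin : BddMeas fun x => b x * w x - a x := (hb.mul hw.bddMeas).sub ha
  have hF : ∀ u : ℝ → ℝ, Continuous u → (∀ x, u (x + 2 * Real.pi) = u x) →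
      (∀ x, u x ∈ Set.Icc (ε * w x) (t * w x)) →
      BddMeas fun x => b x * u x ^ p - a x * u x ^ s := by
    intro u hc hp hu
    have hpow : ∀ r : ℝ, BddMeas fun x => u x ^ r := fun r =>
      .of_periodic (hc.rpow_const fun x => Or.inl (hm.trans_le (hmem x _ (hu x)).1).ne')
        fun x => by simp only [hp]
    exact (hb.mul (hpow p)).sub (ha.mul (hpow s))
  have hIcc : ∀ x, ε * w x ≤ t * w x := fun x => mul_le_mul_of_nonneg_right hεt (hwpos x).le
  have hscaled : ∀ r x, r * w x =
      helmholtzInv μ (fun x => μ ^ 2 * (r * w x) - r * (b x * w x - a x)) x := fun r x =>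
    (hw.const_mul r).eq_helmholtzInv hμ (hwlin.const_mul r)
      (fun x => by simp only [hap, hbp, hw.1]) x
  have hscaled_bdd : ∀ r, BddMeas fun x => μ ^ 2 * (r * w x) - r * (b x * w x - a x) := fun r =>
    ((hw.bddMeas.const_mul r).const_mul _).sub (hwlin.const_mul r)
  have hR : ∀ u : ℝ → ℝ, Continuous u → (∀ x, u (x + 2 * Real.pi) = u x) →
      (∀ x, u x ∈ Set.Icc (ε * w x) (t * w x)) →
      BddMeas fun x => μ ^ 2 * u x - (b x * u x ^ p - a x * u x ^ s) := fun u hc hp hu =>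
    ((BddMeas.of_periodic hc hp).const_mul _).sub (hF u hc hp hu)
  obtain ⟨u, huc, hup, huI, hu⟩ := exists_eq_helmholtzInv hμ
    (F := fun x y => b x * y ^ p - a x * y ^ s) (d := fun x => p * c * b x)
    (I := fun x => Set.Icc (ε * w x) (t * w x)) (fun _ => isClosed_Icc) hF
    (fun x y => by simp only [hap, hbp]) (hb.const_mul _) (fun x => by simp only [hbp])
    (fun x => mul_nonneg (by positivity) (hb0 x))
    (fun h => hbne (h.mono fun x hx => by
      rwa [mul_eq_zero, or_iff_right (by positivity)] at hx))
    (fun x => by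
      rw [hμ2]
      have h1 : p * b x * c ≤ p * B * max c L :=
        mul_le_mul (mul_le_mul_of_nonneg_left (hB x) hp0.le) (le_max_left _ _) hc.le
          (by positivity)
      have h2 : 0 ≤ -s * A * max 0 L' :=
        mul_nonneg (mul_nonneg (by linarith) hA0) (le_max_left _ _)
      simp only [Λ]
      linarith)
    hmono
    (fun u huc hup hu x => by
      constructor
      · rw [hscaled ε x]
        refine helmholtzInv_mono hμ (hscaled_bdd ε) (hR u huc hup hu) (fun y => ?_) x
        have h1 := (hmono y _ ⟨le_rfl, hIcc y⟩ _ (hu y) (hu y).1).2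
        have h0 : 0 < ε * w y := mul_pos hε (hwpos y)
        have h2 : (ε * w y) ^ p ≤ ε * w y := by
          simpa using rpow_le_rpow_of_exponent_ge h0 (hε1 y) hp
        have h3 : ε ≤ (ε * w y) ^ s :=
          (min_le_left _ _).trans (one_le_rpow_of_pos_of_le_one_of_nonpos h0 (hε1 y) hs.le)
        have h4 := mul_le_mul_of_nonneg_left h2 (hb0 y)
        have h5 := mul_le_mul_of_nonneg_left h3 (ha0 y)
        linarith
      · rw [hscaled t x]
        refine helmholtzInv_mono hμ (hR u huc hup hu) (hscaled_bdd t) (fun y => ?_) x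
        have h1 := (hmono y _ (hu y) _ ⟨hIcc y, le_rfl⟩ (hu y).2).2
        have h2 : t * w y ≤ (t * w y) ^ p := by
          simpa using rpow_le_rpow_of_exponent_le (ht1 y) hp
        have h3 : (t * w y) ^ s ≤ t :=
          (rpow_le_one_of_one_le_of_nonpos (ht1 y) hs.le).trans (le_max_left _ _)
        have h4 := mul_le_mul_of_nonneg_left h2 (hb0 y)
        have h5 := mul_le_mul_of_nonneg_left h3 (ha0 y)
        linarith)
    ⟨fun x => ε * w x, hw.continuous.const_mul ε, fun x => by simp only [hw.1],
      fun x => ⟨le_rfl, hIcc x⟩⟩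
  refine ⟨u, ?_, fun x => hm.trans_le (hmem x _ (huI x)).1⟩
  have hsol := solvesPeriodic_helmholtzInv hμ (hR u huc hup huI)
    (fun x => by simp only [hap, hbp, hup])
  rw [← funext hu] at hsol
  exact hsol.congr fun x => by ring

theorem solvesPeriodic_rpow_unique {a b : ℝ → ℝ} (ha0 : ∀ x, 0 ≤ a x) (hb0 : ∀ x, 0 ≤ b x)
    (hbne : ¬ ∀ᵐ x : ℝ ∂volume, b x = 0) {p s : ℝ} (hp : 0 < p) (hs : s ≤ 0) {u v : ℝ → ℝ}
    (hu : SolvesPeriodic (fun x => b x * u x ^ p - a x * u x ^ s) u)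
    (hv : SolvesPeriodic (fun x => b x * v x ^ p - a x * v x ^ s) v)
    (hu0 : ∀ x, 0 < u x) (hv0 : ∀ x, 0 < v x) : u = v := by
  have hmono : ∀ x y z, 0 < y → y ≤ z → b x * y ^ p - a x * y ^ s ≤ b x * z ^ p - a x * z ^ s :=
    fun x y z hy hyz => sub_le_sub
      (mul_le_mul_of_nonneg_left (rpow_le_rpow hy.le hyz hp.le) (hb0 x))
      (mul_le_mul_of_nonneg_left (rpow_le_rpow_of_nonpos hy hyz hs) (ha0 x))
  have hstrict : ∀ x y z, 0 < b x → 0 < y → y < z →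
      b x * y ^ p - a x * y ^ s < b x * z ^ p - a x * z ^ s :=
    fun x y z hb hy hyz => by
    have h1 := mul_lt_mul_of_pos_left (rpow_lt_rpow hy.le hyz hp) hb
    have h2 := mul_le_mul_of_nonneg_left (rpow_le_rpow_of_nonpos hy hyz.le hs) (ha0 x)
    linarith
  obtain ⟨⟨c, hc⟩, h0⟩ := (hu.sub hv).eq_const_of_mul_nonneg <| ae_of_all _ fun x => by
    rcases le_total (u x) (v x) with h | h
    · exact mul_nonneg_of_nonpos_of_nonpos (sub_nonpos.2 h) (sub_nonpos.2 (hmono x _ _ (hu0 x) h))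
    · exact mul_nonneg (sub_nonneg.2 h) (sub_nonneg.2 (hmono x _ _ (hv0 x) h))
  obtain ⟨x, hbx, hx⟩ : ∃ x, b x ≠ 0 ∧
      (b x * u x ^ p - a x * u x ^ s) - (b x * v x ^ p - a x * v x ^ s) = 0 := by
    by_contra! hcon
    exact hbne (h0.mono fun x hx => by_contra fun hb => hcon x hb hx)
  have hb := lt_of_le_of_ne (hb0 x) hbx.symm
  have huv : u x = v x := by
    rcases lt_trichotomy (u x) (v x) with h | h | h
    · linarith [hstrict x _ _ hb (hu0 x) h]
    · exact h
    · linarith [hstrict x _ _ hb (hv0 x) h]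
  have hc0 : c = 0 := by rw [← hc x, huv, sub_self]
  exact funext fun y => sub_eq_zero.1 ((hc y).trans hc0)

theorem solvesPeriodic_iff {g u : ℝ → ℝ} :
    SolvesPeriodic g u ↔ (∀ x, u (x + 2 * Real.pi) = u x) ∧ ContDiff ℝ 1 u ∧
      (∃ K : NNReal, LipschitzWith K (deriv u)) ∧ ∀ᵐ x : ℝ ∂volume,
        DifferentiableAt ℝ (deriv u) x ∧ deriv (deriv u) x = g x := by
  constructor
  · rintro ⟨hp, v, hd, ⟨K, hK⟩, ha⟩
    obtain rfl : deriv u = v := funext fun x => (hd x).deriv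
    exact ⟨hp, contDiff_one_iff_deriv.2 ⟨fun x => (hd x).differentiableAt, hK.continuous⟩,
      ⟨K, hK⟩, ha.mono fun x hx => ⟨hx.differentiableAt, hx.deriv⟩⟩
  · rintro ⟨hp, hd, hK, ha⟩
    exact ⟨hp, deriv u, fun x => (hd.differentiable one_ne_zero x).hasDerivAt, hK,
      ha.mono fun x hx => hx.2 ▸ hx.1.hasDerivAt⟩

theorem two_lt_qex {n : ℕ} (hn : 3 ≤ n) : 2 < qex n := by
  have : (3 : ℝ) ≤ n := by exact_mod_cast hn
  rw [qex, lt_div_iff₀ (by linarith)]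
  linarith

/-- Existence and uniqueness for the Lichnerowicz equation on the circle with
bounded coefficients (Proposition 3.6, parts 1 and uniqueness). -/
theorem lichnerowicz_exists_unique (n : ℕ) (hn : 3 ≤ n) (α β : ℝ → ℝ)
    (hαper : ∀ x, α (x + 2 * Real.pi) = α x) (hβper : ∀ x, β (x + 2 * Real.pi) = β x)
    (hαmeas : Measurable α) (hβmeas : Measurable β)
    (hαbd : ∃ C : ℝ, ∀ x, |α x| ≤ C) (hβbd : ∃ C : ℝ, ∀ x, |β x| ≤ C)
    (hα0 : ¬ (∀ᵐ x : ℝ ∂volume, α x = 0)) (hβ0 : ¬ (∀ᵐ x : ℝ ∂volume, β x = 0)) :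
    ∃! u : ℝ → ℝ,
      (∀ x, u (x + 2 * Real.pi) = u x) ∧
      (∀ x, 0 < u x) ∧
      ContDiff ℝ 1 u ∧
      (∃ K : NNReal, LipschitzWith K (deriv u)) ∧
      (∀ᵐ x : ℝ ∂volume,
        DifferentiableAt ℝ (deriv u) x ∧
        -(deriv (deriv u) x) - (α x) ^ 2 * u x ^ (-qex n - 1)
          + (β x) ^ 2 * u x ^ (qex n - 1) = 0) := by
  have hq := two_lt_qex hn
  have hα : BddMeas α := ⟨hαmeas, hαbd⟩
  have hβ : BddMeas β := ⟨hβmeas, hβbd⟩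
  have hα2 : BddMeas fun x => α x ^ 2 := by simpa only [sq] using hα.mul hα
  have hβ2 : BddMeas fun x => β x ^ 2 := by simpa only [sq] using hβ.mul hβ
  have hβ2ne : ¬ ∀ᵐ x : ℝ ∂volume, β x ^ 2 = 0 := by simpa using hβ0
  have hequiv : ∀ u : ℝ → ℝ, SolvesPeriodic
      (fun x => β x ^ 2 * u x ^ (qex n - 1) - α x ^ 2 * u x ^ (-qex n - 1)) u ↔ _ := fun u =>
    solvesPeriodic_iff
  have heq : ∀ u'' A B : ℝ, u'' = B - A ↔ -u'' - A + B = 0 := fun u'' A B =>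
    ⟨fun h => by rw [h]; ring, fun h => by linarith⟩
  simp only [heq] at hequiv
  obtain ⟨u, hu, hu0⟩ := exists_pos_solvesPeriodic_rpow hα2 hβ2
    (fun x => by simp only [hαper]) (fun x => by simp only [hβper])
    (fun x => sq_nonneg _) (fun x => sq_nonneg _) (by simpa using hα0) hβ2ne
    (p := qex n - 1) (s := -qex n - 1) (by linarith) (by linarith)
  obtain ⟨h1, h2, h3, h4⟩ := (hequiv u).1 hu
  refine ⟨u, ⟨h1, hu0, h2, h3, h4⟩, ?_⟩
  rintro v ⟨k1, hv0, k2, k3, k4⟩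
  exact solvesPeriodic_rpow_unique (fun x => sq_nonneg (α x)) (fun x => sq_nonneg (β x)) hβ2ne
    (by linarith) (by linarith) ((hequiv v).2 ⟨k1, k2, k3, k4⟩) hu hv0 hu0
end
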